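/- arXiv:1709.09288 — 3 statements merged into one kernel-verified Lean document; each statement's English description precedes it below -/
import Mathlib

section
/- Let G be a finite abelian group, let A ⊆ G be a nonempty subset with ⟨A - A⟩ = G, and let n be an integer with n ≥ exp(G) and n|A| > |G|. Then the n-fold sumset nA equals G. -/
open Pointwise

section Isoperimetry

open Finset

variable {G : Type*} [AddCommGroup G]

section DecidableEq

variable [DecidableEq G]

/-- Any two distinct translates of `M` share at most one element. -/
def IsSidon (M : Finset G) : Prop := ∀ g : G, g ≠ 0 → #(M ∩ (g +ᵥ M)) ≤ 1

lemma add_mem_of_card_add_le {S A : Finset G} (h : #(S + A) ≤ #S) {k x : G}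
    (hk : k ∈ AddSubgroup.closure ((A : Set G) - (A : Set G))) (hx : x ∈ S) : x + k ∈ S := by
  have hA {a : G} (ha : a ∈ A) : a +ᵥ S = S + A := by
    refine eq_of_subset_of_card_le ?_ (by rwa [card_vadd_finset])
    intro z hz
    obtain ⟨y, hy, rfl⟩ := mem_vadd_finset.1 hz
    exact mem_add.2 ⟨y, hy, a, ha, add_comm _ _⟩
  have hle : AddSubgroup.closure ((A : Set G) - (A : Set G)) ≤ AddAction.stabilizer G S := by
    rw [AddSubgroup.closure_le]
    rintro _ ⟨a, ha, b, hb, rfl⟩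
    rw [SetLike.mem_coe, AddAction.mem_stabilizer_iff]
    show (a - b) +ᵥ S = S
    rw [sub_eq_neg_add, add_vadd, hA ha, ← hA hb, neg_vadd_vadd]
  have hk' : k +ᵥ S = S := hle hk
  rw [← hk']
  exact mem_vadd_finset.2 ⟨x, hx, add_comm _ _⟩

lemma add_mem_of_card_add_le_of_zero_mem {S A : Finset G} (h : #(S + A) ≤ #S) (h0 : 0 ∈ A)
    {k x : G} (hk : k ∈ AddSubgroup.closure (A : Set G)) (hx : x ∈ S) : x + k ∈ S := by
  refine add_mem_of_card_add_le h (AddSubgroup.closure_mono ?_ hk) hx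
  intro a ha
  exact ⟨a, ha, 0, h0, sub_zero a⟩

lemma IsSidon.card_inter_le {Q : Finset G} (hQ : IsSidon Q) {x y : G} (hxy : x ≠ y) :
    #((x +ᵥ Q) ∩ (y +ᵥ Q)) ≤ 1 := by
  have h := hQ (y - x) (sub_ne_zero.2 hxy.symm)
  rwa [← card_vadd_finset x, vadd_finset_inter, vadd_vadd, add_sub_cancel] at h

lemma vadd_subset_add {P Q : Finset G} {x : G} (hx : x ∈ P) : x +ᵥ Q ⊆ P + Q := by
  intro z hz
  obtain ⟨y, hy, rfl⟩ := mem_vadd_finset.1 hz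
  exact add_mem_add hx hy

lemma IsSidon.two_mul_card_le {P Q : Finset G} (hQ : IsSidon Q) (hP : 2 ≤ #P) :
    2 * #Q ≤ #(P + Q) + 1 := by
  obtain ⟨x, hx, y, hy, hxy⟩ := one_lt_card.1 hP
  have h1 := card_union_add_card_inter (x +ᵥ Q) (y +ᵥ Q)
  have h2 := hQ.card_inter_le hxy
  have h3 := card_le_card (union_subset (vadd_subset_add (Q := Q) hx) (vadd_subset_add hy))
  rw [card_vadd_finset, card_vadd_finset] at h1
  omega

lemma IsSidon.three_mul_card_le {P Q : Finset G} (hQ : IsSidon Q) (hP : 3 ≤ #P) :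
    3 * #Q ≤ #(P + Q) + 3 := by
  obtain ⟨x, y, z, hx, hy, hz, hxy, hxz, hyz⟩ := two_lt_card_iff.1 hP
  have h1 := card_union_add_card_inter (x +ᵥ Q) (y +ᵥ Q)
  have h2 := hQ.card_inter_le hxy
  have h3 := card_union_add_card_inter ((x +ᵥ Q) ∪ (y +ᵥ Q)) (z +ᵥ Q)
  have h4 := card_le_card (union_subset (union_subset (vadd_subset_add (Q := Q) hx)
    (vadd_subset_add hy)) (vadd_subset_add hz))
  have h5 : #(((x +ᵥ Q) ∪ (y +ᵥ Q)) ∩ (z +ᵥ Q)) ≤ 2 := by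
    rw [union_inter_distrib_right]
    exact (card_union_le _ _).trans (add_le_add (hQ.card_inter_le hxz) (hQ.card_inter_le hyz))
  rw [card_vadd_finset] at h1 h3
  rw [card_vadd_finset] at h1
  omega

lemma sub_nsmul_mem_or_exists_add_eq (H : AddSubgroup G) {A : Finset G} (a : G) :
    ∀ (k : ℕ) (s : G), s ∈ k • A → s - k • a ∈ H ∨
      ∃ l, k = l + 1 ∧ ∃ b ∈ A, b - a ∉ H ∧ ∃ t ∈ l • A, s = b + t := by
  intro k
  induction k with
  | zero =>
    intro s hs
    left
    rw [zero_nsmul, mem_zero] at hs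
    simp [hs]
  | succ k ih =>
    intro s hs
    rw [succ_nsmul'] at hs
    obtain ⟨c, hc, t, ht, rfl⟩ := mem_add.1 hs
    by_cases hca : c - a ∈ H
    · rcases ih t ht with h | ⟨l, rfl, b, hb, hba, r, hr, rfl⟩
      · left
        have : c + t - (k + 1) • a = (c - a) + (t - k • a) := by
          rw [succ_nsmul']; abel
        rw [this]
        exact H.add_mem hca h
      · refine Or.inr ⟨l + 1, rfl, b, hb, hba, c + r, ?_, by abel⟩
        rw [succ_nsmul']
        exact add_mem_add hc hr
    · exact Or.inr ⟨k, rfl, c, hc, hca, t, ht, rfl⟩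

end DecidableEq

section Fintype

variable [Fintype G]

open Classical in
/-- The elements of a subgroup, as a finset. -/
noncomputable def AddSubgroup.elements (H : AddSubgroup G) : Finset G :=
  univ.filter (· ∈ H)

@[simp]
lemma AddSubgroup.mem_elements {H : AddSubgroup G} {x : G} : x ∈ H.elements ↔ x ∈ H := by
  simp [AddSubgroup.elements]

lemma AddSubgroup.card_elements_top : #(⊤ : AddSubgroup G).elements = Fintype.card G := by
  rw [← card_univ]; congr 1; ext; simp

end Fintype

variable [Fintype G] [DecidableEq G]

lemma mem_vadd_elements {H : AddSubgroup G} {x y : G} :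
    y ∈ x +ᵥ H.elements ↔ y - x ∈ H := by
  rw [mem_vadd_finset]
  constructor
  · rintro ⟨h, hh, rfl⟩
    simpa using hh
  · intro h
    exact ⟨y - x, by simpa using h, by simp⟩

/-- `X` is a subset of `K` with at least two elements such that `X + A` misses at least two
elements of `K`. -/
structure Separates (K : AddSubgroup G) (A X : Finset G) : Prop where
  subset : ∀ x ∈ X, x ∈ K
  two_le : 2 ≤ #X
  card_add_le : #(X + A) + 2 ≤ #K.elements

lemma Separates.vadd {K : AddSubgroup G} {A X : Finset G} (h : Separates K A X) {g : G}
    (hg : g ∈ K) : Separates K A (g +ᵥ X) := by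
  refine ⟨?_, ?_, ?_⟩
  · intro x hx
    obtain ⟨y, hy, rfl⟩ := mem_vadd_finset.1 hx
    exact K.add_mem hg (h.subset y hy)
  · rw [card_vadd_finset]; exact h.two_le
  · rw [vadd_add_assoc, card_vadd_finset]; exact h.card_add_le

/-- The dual of a separating set. -/
lemma Separates.exists_dual {K : AddSubgroup G} {A X : Finset G} (h : Separates K A X)
    (hA : ∀ a ∈ A, a ∈ K) :
    ∃ Y, Separates K A Y ∧ #Y + #(X + A) = #K.elements ∧ #(Y + A) + #X ≤ #K.elements := by
  have hXA : X + A ⊆ K.elements := by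
    intro z hz
    obtain ⟨x, hx, a, ha, rfl⟩ := mem_add.1 hz
    simpa using K.add_mem (h.subset x hx) (hA a ha)
  have hX : -X ⊆ K.elements := by
    intro z hz
    have := h.subset _ (mem_neg'.1 hz)
    simpa using this
  have hc : #(-(K.elements \ (X + A))) + #(X + A) = #K.elements := by
    rw [card_neg]; exact card_sdiff_add_card_eq_card hXA
  have hs : -(K.elements \ (X + A)) + A ⊆ K.elements \ (-X) := by
    intro z hz
    obtain ⟨y, hy, a, ha, rfl⟩ := mem_add.1 hz
    rw [mem_neg', mem_sdiff, AddSubgroup.mem_elements] at hy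
    rw [mem_sdiff, AddSubgroup.mem_elements, mem_neg']
    refine ⟨K.add_mem (by simpa using hy.1) (hA a ha), fun hx ↦ hy.2 ?_⟩
    exact mem_add.2 ⟨_, hx, a, ha, by abel⟩
  have hc' : #(-(K.elements \ (X + A)) + A) + #X ≤ #K.elements := by
    have h1 := card_le_card hs
    have h2 := card_sdiff_add_card_eq_card hX
    rw [card_neg] at h2
    omega
  have := h.two_le
  have := h.card_add_le
  refine ⟨-(K.elements \ (X + A)), ⟨?_, by omega, by omega⟩, hc, hc'⟩
  intro x hx
  rw [mem_neg', mem_sdiff, AddSubgroup.mem_elements] at hx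
  simpa using hx.1

lemma Separates.exists_atom {K : AddSubgroup G} {A X : Finset G} (h : Separates K A X)
    (hA : ∀ a ∈ A, a ∈ K) (hne : A.Nonempty) :
    ∃ M, Separates K A M ∧ #(M + A) + #X ≤ #(X + A) + #M ∧
      ∀ g : G, g +ᵥ M = M ∨ #(M ∩ (g +ᵥ M)) ≤ 1 := by
  classical
  have hle (Y : Finset G) : #Y ≤ #(Y + A) := card_le_card_add_right hne
  obtain ⟨F, hF, hFmin⟩ := exists_min_image (univ.filter (Separates K A))
    (fun Y ↦ #(Y + A) - #Y) ⟨X, by simpa using h⟩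
  obtain ⟨M, hM, hMmin⟩ := exists_min_image
    (univ.filter fun Y ↦ Separates K A Y ∧ #(Y + A) - #Y = #(F + A) - #F)
    card ⟨F, by simpa using hF⟩
  simp only [mem_filter, mem_univ, true_and] at hF hFmin hM hMmin
  have hmin (Y) (hY : Separates K A Y) : #(M + A) + #Y ≤ #(Y + A) + #M := by
    have := hFmin Y hY
    have := hle Y
    have := hle M
    omega
  have hmin' (Y) (hY : Separates K A Y) (hlt : #Y < #M) : #(M + A) + #Y < #(Y + A) + #M := by
    by_contra hcon
    have h1 := hmin Y hY
    have h2 := hle Y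
    have h3 := hle M
    have := hMmin Y ⟨hY, by omega⟩
    omega
  refine ⟨M, hM.1, hmin X h, fun g ↦ ?_⟩
  by_contra! hcon
  obtain ⟨hne', hint⟩ := hcon
  have hgK : g ∈ K := by
    obtain ⟨x, hx⟩ := card_pos.1 (show 0 < #(M ∩ (g +ᵥ M)) by omega)
    obtain ⟨hx1, hx2⟩ := mem_inter.1 hx
    obtain ⟨y, hy, rfl⟩ := mem_vadd_finset.1 hx2
    have := K.sub_mem (hM.1.subset _ hx1) (hM.1.subset _ hy)
    simpa using this
  have hN := hM.1.vadd hgK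
  obtain ⟨D, hD, hD1, hD2⟩ := hM.1.exists_dual hA
  have hcN : #(g +ᵥ M) = #M := card_vadd_finset _ _
  have hcNA : #((g +ᵥ M) + A) = #(M + A) := by rw [vadd_add_assoc, card_vadd_finset]
  have hMD : #M ≤ #D := by
    by_contra hcon
    have := hmin' D hD (by omega)
    omega
  have hlt : #(M ∩ (g +ᵥ M)) < #M := by
    refine lt_of_le_of_ne (card_le_card inter_subset_left) fun heq ↦ hne' ?_
    have h1 := eq_of_subset_of_card_le inter_subset_left heq.ge
    exact (eq_of_subset_of_card_le (inter_eq_left.1 h1) hcN.le).symm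
  have hI : Separates K A (M ∩ (g +ᵥ M)) := by
    refine ⟨fun x hx ↦ hM.1.subset x (mem_of_mem_inter_left hx), hint, ?_⟩
    have := card_le_card (add_subset_add_right (t := A) (inter_subset_left (s₁ := M) (s₂ := g +ᵥ M)))
    have := hM.1.card_add_le
    omega
  have hI' := hmin' _ hI hlt
  have hsub : #((M ∪ (g +ᵥ M)) + A) + #((M ∩ (g +ᵥ M)) + A) ≤ 2 * #(M + A) := by
    have h1 := card_union_add_card_inter (M + A) ((g +ᵥ M) + A)
    have h2 : #((M ∩ (g +ᵥ M)) + A) ≤ #((M + A) ∩ ((g +ᵥ M) + A)) :=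
      card_le_card inter_add_subset
    rw [union_add]
    omega
  have hcu := card_union_add_card_inter M (g +ᵥ M)
  have hU : Separates K A (M ∪ (g +ᵥ M)) := by
    refine ⟨?_, ?_, by omega⟩
    · intro x hx
      rcases mem_union.1 hx with hx | hx
      exacts [hM.1.subset x hx, hN.subset x hx]
    · have := hM.1.two_le
      omega
  have := hmin _ hU
  omega

lemma Separates.exists_subgroup_or_isSidon {K : AddSubgroup G} {A X : Finset G}
    (h : Separates K A X) (hA : ∀ a ∈ A, a ∈ K) (hne : A.Nonempty) :
    ∃ M, Separates K A M ∧ #(M + A) + #X ≤ #(X + A) + #M ∧ 0 ∈ M ∧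
      ((∃ L : AddSubgroup G, M = L.elements) ∨ IsSidon M) := by
  obtain ⟨N, hN, hNX, hNg⟩ := h.exists_atom hA hne
  obtain ⟨m, hm⟩ := card_pos.1 (show 0 < #N by have := hN.two_le; omega)
  refine ⟨-m +ᵥ N, hN.vadd (K.neg_mem (hN.subset m hm)), ?_, ?_, ?_⟩
  · rwa [vadd_add_assoc, card_vadd_finset, card_vadd_finset]
  · exact mem_vadd_finset.2 ⟨m, hm, by simp⟩
  have h0 : 0 ∈ -m +ᵥ N := mem_vadd_finset.2 ⟨m, hm, by simp⟩
  have hg (g : G) : g +ᵥ (-m +ᵥ N) = -m +ᵥ N ∨ #((-m +ᵥ N) ∩ (g +ᵥ (-m +ᵥ N))) ≤ 1 := by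
    rw [vadd_comm g (-m) N, ← vadd_finset_inter, card_vadd_finset]
    exact (hNg g).imp_left fun h ↦ by rw [h]
  generalize -m +ᵥ N = M at *
  by_cases hs : IsSidon M
  · exact Or.inr hs
  left
  unfold IsSidon at hs
  push Not at hs
  obtain ⟨g, hg0, hg1⟩ := hs
  have hgM : g +ᵥ M = M := (hg g).resolve_right (by omega)
  have hsub {x y : G} (hx : x ∈ M) (hy : y ∈ M) : y - x ∈ M := by
    have hxM : -x +ᵥ M = M := by
      refine (hg (-x)).resolve_right fun hle ↦ hg0 ?_
      refine card_le_one.1 hle g ?_ 0 ?_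
      · refine mem_inter.2 ⟨?_, mem_vadd_finset.2 ⟨g + x, ?_, by simp⟩⟩
        · rw [← hgM]; exact mem_vadd_finset.2 ⟨0, h0, by simp⟩
        · rw [← hgM]; exact mem_vadd_finset.2 ⟨x, hx, by simp⟩
      · exact mem_inter.2 ⟨h0, mem_vadd_finset.2 ⟨x, hx, by simp⟩⟩
    rw [← hxM]
    exact mem_vadd_finset.2 ⟨y, hy, by simp [sub_eq_neg_add]⟩
  have hneg {x : G} (hx : x ∈ M) : -x ∈ M := by simpa using hsub hx h0
  refine ⟨{ carrier := M, zero_mem' := h0, neg_mem' := hneg, add_mem' := ?_ }, ?_⟩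
  · intro a b ha hb
    simpa using hsub (hneg hb) ha
  · ext x
    simp [AddSubgroup.elements, ← SetLike.mem_coe]

/-- A Sidon set with at least three elements expands like a set without structure inside the
subgroup that it generates. -/
lemma IsSidon.card_add_card_le {M X : Finset G} (hM : IsSidon M) (h0 : 0 ∈ M) (h3 : 3 ≤ #M)
    (hX : Separates (AddSubgroup.closure (M : Set G)) M X) : #X + #M ≤ #(X + M) := by
  by_contra! hcon
  have hMK : ∀ a ∈ M, a ∈ AddSubgroup.closure (M : Set G) :=
    fun a ha ↦ AddSubgroup.subset_closure ha
  obtain ⟨N, hN, hNX, hN0, hNor⟩ := hX.exists_subgroup_or_isSidon hMK ⟨0, h0⟩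
  have h2 := hN.two_le
  have hNM := hM.two_mul_card_le h2
  rcases hNor with ⟨L, rfl⟩ | hNs
  · have hML : ∃ m ∈ M, m ∉ L := by
      by_contra! hcon'
      have hle : (AddSubgroup.closure (M : Set G)).elements ⊆ L.elements := by
        intro x hx
        rw [AddSubgroup.mem_elements] at hx ⊢
        exact (AddSubgroup.closure_le L).2 hcon' hx
      have h4 := card_le_card hle
      have h5 : #L.elements ≤ #(L.elements + M) := card_le_card_add_right ⟨0, h0⟩
      have := hN.card_add_le
      omega
    obtain ⟨m, hm, hmL⟩ := hML
    have hd : Disjoint L.elements (m +ᵥ L.elements) := by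
      rw [disjoint_left]
      intro x hx hx'
      rw [mem_vadd_elements] at hx'
      rw [AddSubgroup.mem_elements] at hx
      exact hmL (by simpa using L.sub_mem hx hx')
    have hs : L.elements ∪ (m +ᵥ L.elements) ⊆ L.elements + M := by
      refine union_subset (subset_add_left _ h0) ?_
      rw [add_comm]
      exact vadd_subset_add hm
    have h4 := card_le_card hs
    rw [card_union_of_disjoint hd, card_vadd_finset] at h4
    omega
  · rcases h2.eq_or_lt with h2 | h2
    · omega
    · have h4 := hM.three_mul_card_le h2
      have h5 := hNs.three_mul_card_le h3
      rw [add_comm M N] at h5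
      omega

lemma IsSidon.card_add_card_le_succ {M X : Finset G} (hM : IsSidon M) (h0 : 0 ∈ M)
    (h2 : 2 ≤ #M) (hXK : ∀ x ∈ X, x ∈ AddSubgroup.closure (M : Set G)) (hX : X.Nonempty)
    (hne : X + M ≠ (AddSubgroup.closure (M : Set G)).elements) : #X + #M ≤ #(X + M) + 1 := by
  have hMK : ∀ a ∈ M, a ∈ AddSubgroup.closure (M : Set G) :=
    fun a ha ↦ AddSubgroup.subset_closure ha
  by_cases hX1 : #X = 1
  · have : #M ≤ #(X + M) := card_le_card_add_left hX
    omega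
  have hX2 : 2 ≤ #X := by
    have := hX.card_pos
    omega
  by_cases hc : #(X + M) + 2 ≤ #(AddSubgroup.closure (M : Set G)).elements
  · rcases h2.eq_or_lt with h2 | h2
    · by_contra! hcon
      have hle : #(X + M) ≤ #X := by omega
      refine hne (Subset.antisymm ?_ ?_)
      · intro z hz
        obtain ⟨x, hx, a, ha, rfl⟩ := mem_add.1 hz
        simpa using add_mem (hXK x hx) (hMK a ha)
      · intro z hz
        obtain ⟨x, hx⟩ := hX
        rw [AddSubgroup.mem_elements] at hz
        have := add_mem_of_card_add_le_of_zero_mem hle h0 (sub_mem hz (hXK x hx)) hx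
        rw [add_sub_cancel] at this
        exact subset_add_left _ h0 this
    · exact (hM.card_add_card_le h0 h2 ⟨hXK, hX2, hc⟩).trans (Nat.le_succ _)
  · have hsub : X + M ⊆ (AddSubgroup.closure (M : Set G)).elements := by
      intro z hz
      obtain ⟨x, hx, a, ha, rfl⟩ := mem_add.1 hz
      simpa using add_mem (hXK x hx) (hMK a ha)
    obtain ⟨u, hu, hu'⟩ := exists_of_ssubset (hsub.ssubset_of_ne hne)
    rw [AddSubgroup.mem_elements] at hu
    have hd : Disjoint X (u +ᵥ -M) := by
      rw [disjoint_left]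
      intro x hx hx'
      obtain ⟨y, hy, rfl⟩ := mem_vadd_finset.1 hx'
      exact hu' (mem_add.2 ⟨_, hx, -y, mem_neg'.1 hy, by simp⟩)
    have hs : X ∪ (u +ᵥ -M) ⊆ (AddSubgroup.closure (M : Set G)).elements := by
      refine union_subset (fun x hx ↦ by simpa using hXK x hx) fun x hx ↦ ?_
      obtain ⟨y, hy, rfl⟩ := mem_vadd_finset.1 hx
      have := add_mem hu (neg_mem (hMK _ (mem_neg'.1 hy)))
      simpa using this
    have h4 := card_le_card hs
    rw [card_union_of_disjoint hd, card_vadd_finset, card_neg] at h4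
    omega

/-- `A` fills the cosets of `H` that it meets up to fewer than `|H|` missing elements. -/
def NearlyPeriodic (H : AddSubgroup G) (A : Finset G) : Prop :=
  #(A + H.elements) < #A + #H.elements

lemma IsSidon.nearlyPeriodic {M A : Finset G} (hM : IsSidon M) (h0 : 0 ∈ M) (h2 : 2 ≤ #M)
    (hA : #(A + M) < #A + #M) : NearlyPeriodic (AddSubgroup.closure (M : Set G)) A := by
  unfold NearlyPeriodic
  set K := AddSubgroup.closure (M : Set G) with hK
  have hMK : ∀ a ∈ M, a ∈ K := fun a ha ↦ AddSubgroup.subset_closure ha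
  by_cases hfull : ∀ x ∈ A, (A ∩ (x +ᵥ K.elements)) + M = x +ᵥ K.elements
  · have hsub : A + K.elements ⊆ A + M := by
      intro z hz
      obtain ⟨x, hx, k, hk, rfl⟩ := mem_add.1 hz
      have : x + k ∈ x +ᵥ K.elements := mem_vadd_finset.2 ⟨k, hk, rfl⟩
      rw [← hfull x hx] at this
      exact add_subset_add_right inter_subset_left this
    have h4 := card_le_card hsub
    have h5 : #M ≤ #K.elements := card_le_card fun a ha ↦ by simpa using hMK a ha
    omega
  push Not at hfull
  obtain ⟨x, hx, hne⟩ := hfull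
  have hxA : x ∈ A ∩ (x +ᵥ K.elements) :=
    mem_inter.2 ⟨hx, by rw [mem_vadd_elements]; simp⟩
  have h5 : #(A ∩ (x +ᵥ K.elements)) + #M ≤ #((A ∩ (x +ᵥ K.elements)) + M) + 1 := by
    have := hM.card_add_card_le_succ (X := -x +ᵥ (A ∩ (x +ᵥ K.elements))) h0 h2 ?_
      ⟨0, mem_vadd_finset.2 ⟨x, hxA, by simp⟩⟩ ?_
    · rwa [vadd_add_assoc, card_vadd_finset, card_vadd_finset] at this
    · intro z hz
      obtain ⟨y, hy, rfl⟩ := mem_vadd_finset.1 hz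
      have := mem_vadd_elements.1 (mem_inter.1 hy).2
      rwa [vadd_eq_add, neg_add_eq_sub]
    · intro heq
      apply hne
      rw [vadd_add_assoc] at heq
      rw [← hK] at heq
      conv_rhs => rw [← heq, vadd_neg_vadd]
  have hdisj : Disjoint ((A \ (x +ᵥ K.elements)) + M) ((A ∩ (x +ᵥ K.elements)) + M) := by
    rw [disjoint_left]
    intro z hz hz'
    obtain ⟨y, hy, a, ha, rfl⟩ := mem_add.1 hz
    obtain ⟨y', hy', a', ha', heq⟩ := mem_add.1 hz'
    rw [mem_sdiff, mem_vadd_elements] at hy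
    rw [mem_inter, mem_vadd_elements] at hy'
    apply hy.2
    have : y - x = (y' - x) + (a' - a) := by
      rw [eq_sub_of_add_eq heq]; abel
    rw [this]
    exact K.add_mem hy'.2 (K.sub_mem (hMK _ ha') (hMK _ ha))
  have hunion : ((A \ (x +ᵥ K.elements)) + M) ∪ ((A ∩ (x +ᵥ K.elements)) + M) = A + M := by
    rw [← union_add, sdiff_union_inter]
  have h6 := card_union_of_disjoint hdisj
  rw [hunion] at h6
  have h7 := card_sdiff_add_card_inter A (x +ᵥ K.elements)
  have hB : #((A \ (x +ᵥ K.elements)) + M) ≤ #(A \ (x +ᵥ K.elements)) := by omega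
  have hsub : A + K.elements ⊆ (A \ (x +ᵥ K.elements)) ∪ (x +ᵥ K.elements) := by
    intro z hz
    obtain ⟨y, hy, k, hk, rfl⟩ := mem_add.1 hz
    rw [AddSubgroup.mem_elements] at hk
    by_cases hyx : y ∈ x +ᵥ K.elements
    · refine mem_union_right _ ?_
      rw [mem_vadd_elements] at hyx ⊢
      rw [add_sub_right_comm]
      exact K.add_mem hyx hk
    · exact mem_union_left _
        (add_mem_of_card_add_le_of_zero_mem hB h0 hk (mem_sdiff.2 ⟨hy, hyx⟩))
  have h8 := card_le_card hsub
  have h9 := card_union_le (A \ (x +ᵥ K.elements)) (x +ᵥ K.elements)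
  have h10 := card_pos.2 ⟨x, hxA⟩
  rw [card_vadd_finset] at h9
  omega

/-- A set with small expansion is nearly periodic, unless the ambient group is cyclic. -/
lemma exists_nearlyPeriodic_or_isAddCyclic {A X : Finset G} (hA : 2 ≤ #A) (hX : 2 ≤ #X)
    (hXA : #(X + A) + 2 ≤ Fintype.card G) (hlt : #(X + A) < #X + #A) :
    (∃ H : AddSubgroup G, H ≠ ⊥ ∧ H ≠ ⊤ ∧ NearlyPeriodic H A) ∨ IsAddCyclic G := by
  have hsep : Separates ⊤ A X := ⟨by simp, hX, by rwa [AddSubgroup.card_elements_top]⟩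
  have hAne : A.Nonempty := card_pos.1 (by omega)
  obtain ⟨M, hM, hMX, h0, hMor⟩ := hsep.exists_subgroup_or_isSidon (by simp) hAne
  have hMc := hM.card_add_le
  have hM2 := hM.two_le
  have hMA : #(A + M) < #A + #M := by
    rw [add_comm A]; omega
  have hMG : #M ≤ #(M + A) := card_le_card_add_right hAne
  rw [AddSubgroup.card_elements_top] at hMc
  rcases hMor with ⟨H, rfl⟩ | hMs
  · refine Or.inl ⟨H, ?_, ?_, hMA⟩
    · rintro rfl
      have : (⊥ : AddSubgroup G).elements = {0} := by ext; simp
      simp [this] at hM2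
    · rintro rfl
      rw [AddSubgroup.card_elements_top] at hMG
      omega
  have hKn := hMs.nearlyPeriodic h0 hM2 hMA
  by_cases htop : AddSubgroup.closure (M : Set G) = ⊤
  · right
    rcases hM2.eq_or_lt with h2 | h3
    · obtain ⟨m, hm, hm0⟩ := exists_mem_ne (s := M) (by omega) 0
      have hM' : M = {0, m} := by
        symm
        refine eq_of_subset_of_card_le ?_ ?_
        · simp [insert_subset_iff, h0, hm]
        · rw [card_pair hm0.symm]; omega
      refine ⟨m, fun x ↦ ?_⟩
      have : AddSubgroup.closure (M : Set G) ≤ AddSubgroup.zmultiples m := by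
        rw [AddSubgroup.closure_le, hM']
        intro y hy
        simp only [coe_insert, coe_singleton, Set.mem_insert_iff, Set.mem_singleton_iff] at hy
        rcases hy with rfl | rfl
        exacts [zero_mem _, AddSubgroup.mem_zmultiples _]
      rw [htop] at this
      exact this (AddSubgroup.mem_top x)
    · have := hMs.card_add_card_le (X := A) h0 h3
        ⟨by simp [htop], hA, by rw [htop, AddSubgroup.card_elements_top, add_comm A]; exact hMc⟩
      omega
  · refine Or.inl ⟨_, ?_, htop, hKn⟩
    intro hbot
    rw [AddSubgroup.closure_eq_bot_iff] at hbot
    have : M ⊆ {0} := by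
      intro x hx
      simpa using hbot hx
    have := card_le_card this
    simp at this
    omega

lemma NearlyPeriodic.card_lt {H : AddSubgroup G} {A : Finset G} (h : NearlyPeriodic H A)
    {x y : G} (hx : x ∈ A) (hy : y ∈ A) (hxy : y - x ∉ H) :
    #H.elements < #(A ∩ (x +ᵥ H.elements)) + #(A ∩ (y +ᵥ H.elements)) := by
  have hd : Disjoint (x +ᵥ H.elements) (y +ᵥ H.elements) := by
    rw [disjoint_left]
    intro z hz hz'
    rw [mem_vadd_elements] at hz hz'
    exact hxy (by simpa using H.sub_mem hz hz')
  have hs : A ∪ ((x +ᵥ H.elements) ∪ (y +ᵥ H.elements)) ⊆ A + H.elements :=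
    union_subset (subset_add_left _ (by simp))
      (union_subset (vadd_subset_add hx) (vadd_subset_add hy))
  have h1 := card_le_card hs
  have h2 := card_union_add_card_inter A ((x +ᵥ H.elements) ∪ (y +ᵥ H.elements))
  rw [card_union_of_disjoint hd, card_vadd_finset, card_vadd_finset, inter_union_distrib_left]
    at h2
  have h3 := card_union_le (A ∩ (x +ᵥ H.elements)) (A ∩ (y +ᵥ H.elements))
  unfold NearlyPeriodic at h
  omega

lemma add_add_mem_of_card_lt {H : AddSubgroup G} {A : Finset G} {b c h : G}
    (hlt : #H.elements < #(A ∩ (b +ᵥ H.elements)) + #(A ∩ (c +ᵥ H.elements))) (hh : h ∈ H) :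
    b + c + h ∈ A + A := by
  by_contra hcon
  have hd : Disjoint (A ∩ (b +ᵥ H.elements))
      ((b + c + h) +ᵥ -(A ∩ (c +ᵥ H.elements))) := by
    rw [disjoint_left]
    intro z hz hz'
    obtain ⟨y, hy, rfl⟩ := mem_vadd_finset.1 hz'
    exact hcon (mem_add.2 ⟨_, (mem_inter.1 hz).1, -y, (mem_inter.1 (mem_neg'.1 hy)).1, by simp⟩)
  have hs : (A ∩ (b +ᵥ H.elements)) ∪ ((b + c + h) +ᵥ -(A ∩ (c +ᵥ H.elements))) ⊆
      b +ᵥ H.elements := by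
    refine union_subset inter_subset_right fun z hz ↦ ?_
    obtain ⟨y, hy, rfl⟩ := mem_vadd_finset.1 hz
    have hy' := mem_vadd_elements.1 (mem_inter.1 (mem_neg'.1 hy)).2
    rw [mem_vadd_elements]
    have : ((b + c + h) +ᵥ y) - b = h - (-y - c) := by
      rw [vadd_eq_add]; abel
    rw [this]
    exact H.sub_mem hh hy'
  have h1 := card_le_card hs
  rw [card_union_of_disjoint hd, card_vadd_finset, card_vadd_finset, card_neg] at h1
  omega

/-- Apart from one coset, the sum of two cosets of `H` met by `A` is covered by `A + A`. -/
lemma NearlyPeriodic.exists_base {H : AddSubgroup G} {A : Finset G} (hp : NearlyPeriodic H A)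
    (hA : A.Nonempty) :
    ∃ a ∈ A, ∀ b ∈ A, b - a ∉ H → ∀ c ∈ A, ∀ h ∈ H, b + c + h ∈ A + A := by
  by_cases hbad : ∃ a ∈ A, 2 * #(A ∩ (a +ᵥ H.elements)) ≤ #H.elements
  · obtain ⟨a, ha, hle⟩ := hbad
    refine ⟨a, ha, fun b hb hba c hc h hh ↦ add_add_mem_of_card_lt ?_ hh⟩
    by_cases hcb : c - b ∈ H
    · have heq : c +ᵥ H.elements = b +ᵥ H.elements := by
        ext z
        rw [mem_vadd_elements, mem_vadd_elements, ← sub_add_sub_cancel z c b]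
        exact (H.add_mem_cancel_right hcb).symm
      have := hp.card_lt ha hb hba
      rw [heq]
      omega
    · exact hp.card_lt hb hc hcb
  · push Not at hbad
    obtain ⟨a, ha⟩ := hA
    refine ⟨a, ha, fun b hb _ c hc h hh ↦ add_add_mem_of_card_lt ?_ hh⟩
    have := hbad b hb
    have := hbad c hc
    omega

lemma NearlyPeriodic.nsmul_eq_univ {H : AddSubgroup G} {A : Finset G} (hp : NearlyPeriodic H A)
    (hA : A.Nonempty) (hH : H ≠ ⊤)
    (hgen : AddSubgroup.closure ((A : Set G) - (A : Set G)) = ⊤) {n : ℕ}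
    (hn : AddMonoid.exponent G ≤ n) (hq : ∀ g, ∃ s ∈ n • A, g - s ∈ H) :
    n • A = univ := by
  obtain ⟨a, ha, hbase⟩ := hp.exists_base hA
  obtain ⟨b, hb, hba⟩ : ∃ b ∈ A, b - a ∉ H := by
    by_contra! hcon
    apply hH
    rw [eq_top_iff, ← hgen, AddSubgroup.closure_le]
    rintro _ ⟨x, hx, y, hy, rfl⟩
    simpa using H.sub_mem (hcon x hx) (hcon y hy)
  have he0 : AddMonoid.exponent G ≠ 0 := AddMonoid.exponent_ne_zero_of_finite
  have he1 : AddMonoid.exponent G ≠ 1 := by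
    intro h1
    have := AddMonoid.exp_eq_one_iff.1 h1
    exact hba (by rw [Subsingleton.elim (b - a) 0]; exact H.zero_mem)
  obtain ⟨e, he⟩ : ∃ e, AddMonoid.exponent G = e + 2 := ⟨AddMonoid.exponent G - 2, by omega⟩
  obtain ⟨k, rfl⟩ : ∃ k, n = (e + k) + 2 := ⟨n - (e + 2), by omega⟩
  have hmem {c d t h g : G} (hc : c ∈ A) (hca : c - a ∉ H) (hd : d ∈ A) (ht : t ∈ (e + k) • A)
      (hh : h ∈ H) (hg : g = c + d + h + t) : g ∈ (e + k + 2) • A := by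
    rw [add_comm (e + k) 2, add_nsmul, two_nsmul, hg]
    exact add_mem_add (hbase c hc hca d hd h hh) ht
  rw [eq_univ_iff_forall]
  intro g
  obtain ⟨s, hs, hgs⟩ := hq g
  rcases sub_nsmul_mem_or_exists_add_eq H a _ s hs with h | ⟨l, hl, c, hc, hca, t, ht, rfl⟩
  · refine hmem (t := e • b + k • a) hb hba hb ?_ (H.add_mem hgs h) ?_
    · rw [add_nsmul]
      exact add_mem_add (nsmul_mem_nsmul hb) (nsmul_mem_nsmul ha)
    · have hb0 : (e + 2) • b = 0 := by rw [← he]; exact AddMonoid.exponent_nsmul_eq_zero b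
      have ha0 : (e + 2) • a = 0 := by rw [← he]; exact AddMonoid.exponent_nsmul_eq_zero a
      have h1 : (e + k + 2) • a = k • a := by
        rw [show e + k + 2 = (e + 2) + k by ring, add_nsmul, ha0, zero_add]
      have h2 : e • b + 2 • b = 0 := by rw [← add_nsmul, hb0]
      have h3 : b + b + (g - s + (s - k • a)) + (e • b + k • a) = g + (e • b + 2 • b) := by
        rw [two_nsmul]; abel
      rw [h1, h3, h2, add_zero]
  · obtain rfl : l = e + k + 1 := by omega
    rw [succ_nsmul'] at ht
    obtain ⟨d, hd, r, hr, rfl⟩ := mem_add.1 ht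
    exact hmem hc hca hd hr hgs (by abel)

lemma eq_univ_of_card_add_le {S A : Finset G} (hS : S.Nonempty) (h : #(S + A) ≤ #S)
    (hgen : AddSubgroup.closure ((A : Set G) - (A : Set G)) = ⊤) : S = univ := by
  obtain ⟨s, hs⟩ := hS
  rw [eq_univ_iff_forall]
  intro x
  have := add_mem_of_card_add_le h (k := x - s) (by rw [hgen]; trivial) hs
  rwa [add_sub_cancel] at this

lemma nsmul_eq_univ_of_card_le {k : ℕ} {A : Finset G} (hA : A.Nonempty)
    (hgen : AddSubgroup.closure ((A : Set G) - (A : Set G)) = ⊤) (hk : Fintype.card G ≤ k) :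
    k • A = univ := by
  have huniv : (univ : Finset G) + A = univ :=
    eq_univ_of_card _ (le_antisymm (card_le_univ _) (card_le_card_add_right hA))
  have key (j : ℕ) : j • A = univ ∨ j + 1 ≤ #(j • A) := by
    induction j with
    | zero => right; simp
    | succ j ih =>
      by_cases hlt : #(j • A + A) ≤ #(j • A)
      · left
        have h1 := eq_univ_of_card_add_le hA.nsmul hlt hgen
        rw [succ_nsmul, h1]
        exact huniv
      · rcases ih with ih | ih
        · left
          rw [succ_nsmul, ih]
          exact huniv
        · right
          rw [succ_nsmul]
          omega
  refine (key k).resolve_right fun h ↦ ?_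
  have := card_le_univ (k • A)
  omega

lemma card_add_card_le_of_add_ne_univ {S A : Finset G} (h : S + A ≠ univ) :
    #S + #A ≤ Fintype.card G := by
  obtain ⟨u, hu⟩ : ∃ u, u ∉ S + A := by
    by_contra! hcon
    exact h (eq_univ_iff_forall.2 hcon)
  have hd : Disjoint S (u +ᵥ -A) := by
    rw [disjoint_left]
    intro x hx hx'
    obtain ⟨y, hy, rfl⟩ := mem_vadd_finset.1 hx'
    exact hu (mem_add.2 ⟨_, hx, -y, mem_neg'.1 hy, by simp⟩)
  have h1 := card_le_univ (S ∪ (u +ᵥ -A))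
  rwa [card_union_of_disjoint hd, card_vadd_finset, card_neg] at h1

/-- If no set expands badly, then the iterated sumsets grow linearly. -/
lemma nsmul_eq_univ_of_expansion {A : Finset G} (hA : 2 ≤ #A)
    (hexp : ∀ X : Finset G, 2 ≤ #X → #(X + A) + 2 ≤ Fintype.card G → #X + #A ≤ #(X + A))
    {n : ℕ} (hcard : Fintype.card G < n * #A) : n • A = univ := by
  have hAne : A.Nonempty := card_pos.1 (by omega)
  by_contra hne
  obtain ⟨m, rfl⟩ : ∃ m, n = m + 1 := by
    refine Nat.exists_eq_succ_of_ne_zero ?_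
    rintro rfl
    simp at hcard
  rw [succ_nsmul] at hne
  have hm := card_add_card_le_of_add_ne_univ hne
  have key (j : ℕ) (hj : j ≤ m) : j * #A ≤ #(j • A) ∧ #(j • A) ≤ #(m • A) := by
    refine ⟨?_, ?_⟩
    swap
    · obtain ⟨d, rfl⟩ := Nat.exists_eq_add_of_le hj
      rw [add_nsmul]
      exact card_le_card_add_right hAne.nsmul
    induction j with
    | zero => simp
    | succ j ih =>
      have ih := ih (by omega)
      have hle : #((j + 1) • A) ≤ #(m • A) := by
        obtain ⟨d, rfl⟩ := Nat.exists_eq_add_of_le hj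
        rw [add_nsmul _ (j + 1)]
        exact card_le_card_add_right hAne.nsmul
      rcases Nat.eq_zero_or_pos j with rfl | hj0
      · simp
      rw [succ_nsmul] at hle ⊢
      have h2 : 2 ≤ #(j • A) := by nlinarith
      have := hexp (j • A) h2 (by omega)
      linarith [Nat.succ_mul j #A]
  have := (key m le_rfl).1
  linarith [Nat.succ_mul m #A]

end Isoperimetry

theorem nsmul_eq_univ_of_exponent_le_of_card_lt (N : ℕ) :
    ∀ {G : Type*} [AddCommGroup G] [Fintype G] [DecidableEq G] (A : Finset G), A.Nonempty →
      AddSubgroup.closure ((A : Set G) - (A : Set G)) = ⊤ → Fintype.card G = N →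
      ∀ n : ℕ, AddMonoid.exponent G ≤ n → Fintype.card G < n * A.card →
        n • A = Finset.univ := by
  induction N using Nat.strong_induction_on with
  | _ N ih =>
  intro G _ _ _ A hA hgen hN n hn hcard
  by_cases hcyc : IsAddCyclic G
  · refine nsmul_eq_univ_of_card_le hA hgen ?_
    rwa [← Nat.card_eq_fintype_card, ← IsAddCyclic.exponent_eq_card]
  have hA2 : 2 ≤ A.card := by
    by_contra! hlt
    obtain ⟨a, rfl⟩ := Finset.card_eq_one.1 (show A.card = 1 by have := hA.card_pos; omega)
    have hbot : (⊥ : AddSubgroup G) = ⊤ := by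
      rw [← hgen, eq_comm, AddSubgroup.closure_eq_bot_iff]
      simp
    have := subsingleton_of_bot_eq_top hbot
    have := (AddSubgroup.subsingleton_iff (G := G)).1 this
    exact hcyc isAddCyclic_of_subsingleton
  by_cases hexp : ∀ X : Finset G, 2 ≤ X.card → (X + A).card + 2 ≤ Fintype.card G →
      X.card + A.card ≤ (X + A).card
  · exact nsmul_eq_univ_of_expansion hA2 hexp hcard
  push Not at hexp
  obtain ⟨X, hX, hXA, hlt⟩ := hexp
  obtain ⟨H, hbot, htop, hp⟩ :=
    (exists_nearlyPeriodic_or_isAddCyclic hA2 hX hXA hlt).resolve_right hcyc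
  classical
  let _ : Fintype (G ⧸ H) := Fintype.ofFinite _
  have hprod : Fintype.card G = Fintype.card (G ⧸ H) * Nat.card H := by
    rw [← Nat.card_eq_fintype_card, ← Nat.card_eq_fintype_card]
    exact AddSubgroup.card_eq_card_quotient_mul_card_addSubgroup H
  have hH1 : 1 < Nat.card H := (AddSubgroup.one_lt_card_iff_ne_bot H).2 hbot
  have hQ : 0 < Fintype.card (G ⧸ H) := Fintype.card_pos
  have himage : A.card ≤ Nat.card H * (A.image (QuotientAddGroup.mk' H)).card := by
    refine Finset.card_le_mul_card_image _ _ fun y _ ↦ ?_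
    obtain ⟨x, rfl⟩ := QuotientAddGroup.mk'_surjective H y
    have hc : Nat.card H = (x +ᵥ H.elements).card := by
      rw [Finset.card_vadd_finset]
      exact Nat.subtype_card _ fun _ ↦ AddSubgroup.mem_elements
    rw [hc]
    refine Finset.card_le_card fun a ha ↦ ?_
    rw [mem_vadd_elements, sub_eq_neg_add]
    exact QuotientAddGroup.eq.1 (Finset.mem_filter.1 ha).2.symm
  have hquot := ih (Fintype.card (G ⧸ H)) (by nlinarith) (A.image (QuotientAddGroup.mk' H))
    (hA.image _) ?_ rfl n ?_ ?_
  · refine hp.nsmul_eq_univ hA htop hgen hn fun g ↦ ?_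
    rw [← Finset.image_nsmul] at hquot
    obtain ⟨s, hs, hsg⟩ := Finset.mem_image.1 (hquot ▸ Finset.mem_univ (QuotientAddGroup.mk' H g))
    refine ⟨s, hs, ?_⟩
    rw [sub_eq_neg_add]
    exact QuotientAddGroup.eq.1 hsg
  · have h1 := AddMonoidHom.map_closure (QuotientAddGroup.mk' H) ((A : Set G) - (A : Set G))
    rw [hgen, AddSubgroup.map_top_of_surjective _ (QuotientAddGroup.mk'_surjective H),
      Set.image_sub] at h1
    rw [Finset.coe_image]
    exact h1.symm
  · refine le_trans (Nat.le_of_dvd ?_ ?_) hn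
    · exact Nat.pos_of_ne_zero AddMonoid.exponent_ne_zero_of_finite
    · exact AddMonoidHom.exponent_dvd (QuotientAddGroup.mk'_surjective H)
  · nlinarith

theorem stmt9 {G : Type*} [AddCommGroup G] [Fintype G] [DecidableEq G]
    (A : Finset G) (hA : A.Nonempty)
    (hgen : AddSubgroup.closure ((A : Set G) - (A : Set G)) = ⊤)
    (n : ℕ) (hn : AddMonoid.exponent G ≤ n) (hcard : Fintype.card G < n * A.card) :
    n • A = Finset.univ :=
  nsmul_eq_univ_of_exponent_le_of_card_lt _ A hA hgen rfl n hn hcard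
end

section
/- Let G be a finite abelian group, let A ⊆ G be a nonempty subset with ⟨A - A⟩ = G, and let n ≥ exp(G) + 1 be an integer with n ≥ 3. Then |nA| ≥ min{|G|, n|A|}. -/
open Pointwise

namespace IteratedSumset

variable {G : Type*} [AddCommGroup G]

theorem mem_vadd_iff_sub [DecidableEq G] {g x : G} {S : Finset G} :
    x ∈ g +ᵥ S ↔ x - g ∈ S := by
  rw [Finset.mem_vadd_finset]
  constructor
  · rintro ⟨y, hy, rfl⟩
    simpa using hy
  · intro h
    exact ⟨x - g, h, by simp⟩

theorem nsmul_succ_eq [DecidableEq G] (A : Finset G) (n : ℕ) : (n + 1) • A = n • A + A :=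
  succ_nsmul A n

theorem one_nsmul_eq [DecidableEq G] (A : Finset G) : 1 • A = A :=
  one_nsmul A

theorem nsmul_nonempty [DecidableEq G] {A : Finset G} (hA : A.Nonempty) (n : ℕ) :
    (n • A).Nonempty :=
  hA.nsmul

theorem nsmul_mem_nsmul [DecidableEq G] {A : Finset G} {a : G} (ha : a ∈ A) (n : ℕ) :
    n • a ∈ n • A :=
  Finset.nsmul_mem_nsmul ha

theorem add_nsmul_eq [DecidableEq G] (A : Finset G) (m n : ℕ) : (m + n) • A = m • A + n • A :=
  add_nsmul A m n

/-- An element of an iterated sumset either is congruent to a multiple of a single summand or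
admits, up to an element of `H`, a representation with two summands from different cosets. -/
theorem nsmul_dichotomy [DecidableEq G] (A : Finset G) (H : AddSubgroup G) (j : ℕ) {y : G}
    (hy : y ∈ (j + 1) • A) :
    (∃ a ∈ A, y - (j + 1) • a ∈ H) ∨
      ∃ b ∈ A, ∃ c ∈ A, b - c ∉ H ∧ ∃ i, i + 2 = j + 1 ∧ ∃ z ∈ i • A, y - (z + (b + c)) ∈ H := by
  induction j generalizing y with
  | zero =>
    left
    rw [one_nsmul_eq] at hy
    exact ⟨y, hy, by simp⟩
  | succ j ih =>
    rw [nsmul_succ_eq] at hy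
    obtain ⟨y', hy', a, ha, rfl⟩ := Finset.mem_add.1 hy
    rcases ih hy' with ⟨b, hb, h⟩ | ⟨b, hb, c, hc, hbc, i, hi, z, hz, h⟩
    · by_cases hab : a - b ∈ H
      · left
        refine ⟨b, hb, ?_⟩
        have := H.add_mem h hab
        convert this using 1
        rw [succ_nsmul b (j + 1)]
        abel
      · right
        refine ⟨a, ha, b, hb, hab, j, rfl, j • b, nsmul_mem_nsmul hb j, ?_⟩
        convert h using 1
        rw [succ_nsmul b j]
        abel
    · right
      refine ⟨b, hb, c, hc, hbc, i + 1, by omega, z + a, ?_, ?_⟩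
      · rw [nsmul_succ_eq]
        exact Finset.add_mem_add hz ha
      · convert h using 1
        abel

theorem exists_sub_notMem {A : Finset G}
    (hgen : AddSubgroup.closure ((A : Set G) - (A : Set G)) = ⊤) {H : AddSubgroup G} (hH : H ≠ ⊤)
    (a : G) : ∃ b ∈ A, b - a ∉ H := by
  by_contra! hcon
  apply hH
  rw [eq_top_iff, ← hgen, AddSubgroup.closure_le]
  rintro _ ⟨b, hb, c, hc, rfl⟩
  have := H.sub_mem (hcon b hb) (hcon c hc)
  simpa using this

/-- The coset `b + H` as a finset. -/
noncomputable def coset [Finite G] (H : AddSubgroup G) (b : G) : Finset G :=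
  (Set.toFinite {x | x - b ∈ H}).toFinset

/-- The union of the `H`-cosets meeting `A`, that is `A + H`. -/
noncomputable def hull [Finite G] (A : Finset G) (H : AddSubgroup G) : Finset G :=
  (Set.toFinite {x | ∃ a ∈ A, x - a ∈ H}).toFinset

section Basic

variable [Finite G]

@[simp] theorem mem_coset {H : AddSubgroup G} {b x : G} : x ∈ coset H b ↔ x - b ∈ H := by
  simp [coset]

@[simp] theorem mem_hull {A : Finset G} {H : AddSubgroup G} {x : G} :
    x ∈ hull A H ↔ ∃ a ∈ A, x - a ∈ H := by
  simp [hull]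

theorem card_coset (H : AddSubgroup G) (b : G) : (coset H b).card = Nat.card H := by
  have h : {x | x - b ∈ H} = (fun x => x + b) '' (H : Set G) := by
    ext x
    constructor
    · intro hx
      exact ⟨x - b, hx, by simp⟩
    · rintro ⟨y, hy, rfl⟩
      simpa using hy
  rw [coset, ← Set.ncard_eq_toFinset_card, h, Set.ncard_image_of_injective _ (add_left_injective b)]
  rfl

theorem subset_hull (A : Finset G) (H : AddSubgroup G) : A ⊆ hull A H := fun a ha =>
  mem_hull.2 ⟨a, ha, by simp⟩

theorem coset_subset_hull {A : Finset G} {H : AddSubgroup G} {b : G} (hb : b ∈ A) :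
    coset H b ⊆ hull A H := fun x hx => mem_hull.2 ⟨b, hb, by simpa using hx⟩

theorem self_mem_coset (H : AddSubgroup G) (b : G) : b ∈ coset H b := by simp

theorem disjoint_coset {H : AddSubgroup G} {b c : G} (h : b - c ∉ H) :
    Disjoint (coset H b) (coset H c) := by
  rw [Finset.disjoint_left]
  intro x hx hx'
  simp only [mem_coset] at hx hx'
  apply h
  have := H.sub_mem hx' hx
  simpa using this

/-- Two subsets of cosets of `H` with more than `|H|` elements in total have as sumset a
full coset. -/
theorem mem_add_of_card_lt [DecidableEq G] {H : AddSubgroup G} {X Y : Finset G} {b c g : G}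
    (hX : X ⊆ coset H b) (hY : Y ⊆ coset H c) (hcard : Nat.card H < X.card + Y.card)
    (hg : g - (b + c) ∈ H) : g ∈ X + Y := by
  have hZ : Y.image (fun y => g - y) ⊆ coset H b := by
    intro z hz
    obtain ⟨y, hy, rfl⟩ := Finset.mem_image.1 hz
    have h1 := mem_coset.1 (hY hy)
    rw [mem_coset]
    have := H.sub_mem hg h1
    convert this using 1
    abel
  have hZc : (Y.image (fun y => g - y)).card = Y.card :=
    Finset.card_image_of_injective _ fun a b h => by simpa using h
  have hne : ¬ Disjoint X (Y.image (fun y => g - y)) := by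
    intro hd
    have h1 := Finset.card_le_card (Finset.union_subset hX hZ)
    rw [Finset.card_union_of_disjoint hd, hZc, card_coset] at h1
    omega
  obtain ⟨x, hx, hx'⟩ := Finset.not_disjoint_iff.1 hne
  obtain ⟨y, hy, rfl⟩ := Finset.mem_image.1 hx'
  exact Finset.mem_add.2 ⟨g - y, hx, y, hy, by simp⟩

theorem nsmul_periodic_of_card_lt [DecidableEq G] {A : Finset G}
    (hgen : AddSubgroup.closure ((A : Set G) - (A : Set G)) = ⊤) {n : ℕ}
    (hn : AddMonoid.exponent G + 1 ≤ n) {H : AddSubgroup G} (hH : H ≠ ⊤)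
    (hlt : ∀ b ∈ A, ∀ c ∈ A, b - c ∉ H →
      Nat.card H < (A ∩ coset H b).card + (A ∩ coset H c).card)
    {y h : G} (hy : y ∈ n • A) (hh : h ∈ H) : y + h ∈ n • A := by
  have hm : 0 < AddMonoid.exponent G := AddMonoid.exponent_pos.2 AddMonoid.ExponentExists.of_finite
  obtain ⟨j, rfl⟩ : ∃ j, n = j + 1 := ⟨n - 1, by omega⟩
  have key : ∃ b ∈ A, ∃ c ∈ A, b - c ∉ H ∧
      ∃ i, i + 2 = j + 1 ∧ ∃ z ∈ i • A, y - (z + (b + c)) ∈ H := by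
    rcases nsmul_dichotomy A H j hy with ⟨a, ha, h1⟩ | h1
    · obtain ⟨b, hb, hba⟩ := exists_sub_notMem hgen hH a
      obtain ⟨m, hm'⟩ : ∃ m, AddMonoid.exponent G = m + 1 := ⟨_, (Nat.succ_pred_eq_of_pos hm).symm⟩
      obtain ⟨r, hr⟩ : ∃ r, j = m + 1 + r := ⟨j - (m + 1), by omega⟩
      refine ⟨b, hb, a, ha, hba, m + r, by omega, m • b + r • a, ?_, ?_⟩
      · rw [add_nsmul_eq]
        exact Finset.add_mem_add (nsmul_mem_nsmul hb m) (nsmul_mem_nsmul ha r)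
      · have e1 := AddMonoid.exponent_nsmul_eq_zero a
        have e2 := AddMonoid.exponent_nsmul_eq_zero b
        rw [hm'] at e1 e2
        have e3 : (j + 1) • a = r • a + a := by
          rw [hr, succ_nsmul, add_nsmul, e1, zero_add]
        have e4 : m • b + r • a + (b + a) = r • a + a := by
          rw [succ_nsmul] at e2
          calc m • b + r • a + (b + a) = (m • b + b) + (r • a + a) := by abel
            _ = _ := by rw [e2, zero_add]
        rw [e4, ← e3]
        exact h1
    · exact h1
  obtain ⟨b, hb, c, hc, hbc, i, hi, z, hz, h1⟩ := key
  have h2 : y + h - z ∈ (A ∩ coset H b) + (A ∩ coset H c) := by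
    refine mem_add_of_card_lt Finset.inter_subset_right Finset.inter_subset_right
      (hlt b hb c hc hbc) ?_
    have := H.add_mem h1 hh
    convert this using 1
    abel
  obtain ⟨p, hp, q, hq, hpq⟩ := Finset.mem_add.1 h2
  rw [← hi, add_nsmul_eq]
  refine Finset.mem_add.2 ⟨z, hz, p + q, ?_, ?_⟩
  · rw [nsmul_succ_eq, one_nsmul_eq]
    exact Finset.add_mem_add (Finset.mem_inter.1 hp).1 (Finset.mem_inter.1 hq).1
  · rw [hpq]
    abel

theorem card_inter_coset_add_le [DecidableEq G] (A : Finset G) {H : AddSubgroup G} {b c : G}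
    (hb : b ∈ A) (hc : c ∈ A) (hbc : b - c ∉ H) :
    A.card + 2 * Nat.card H ≤
      (hull A H).card + (A ∩ coset H b).card + (A ∩ coset H c).card := by
  have hd : Disjoint (coset H b) (coset H c) := disjoint_coset hbc
  have h1 : (coset H b \ A) ∪ (coset H c \ A) ⊆ hull A H \ A :=
    Finset.union_subset (Finset.sdiff_subset_sdiff (coset_subset_hull hb) subset_rfl)
      (Finset.sdiff_subset_sdiff (coset_subset_hull hc) subset_rfl)
  have h2 := Finset.card_le_card h1
  rw [Finset.card_union_of_disjoint (hd.mono Finset.sdiff_subset Finset.sdiff_subset),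
    Finset.card_sdiff_of_subset (subset_hull A H)] at h2
  have h3 := Finset.card_sdiff_add_card_inter (coset H b) A
  have h4 := Finset.card_sdiff_add_card_inter (coset H c) A
  rw [card_coset, Finset.inter_comm] at h3 h4
  have h5 := Finset.card_le_card (subset_hull A H)
  omega

theorem card_add_card_le_card_hull [DecidableEq G] {A : Finset G}
    (hgen : AddSubgroup.closure ((A : Set G) - (A : Set G)) = ⊤) {n : ℕ}
    (hn : AddMonoid.exponent G + 1 ≤ n)
    (hap : ∀ H : AddSubgroup G, H ≠ ⊥ → ∃ y ∈ n • A, ∃ h ∈ H, y + h ∉ n • A)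
    {H : AddSubgroup G} (hbot : H ≠ ⊥) (htop : H ≠ ⊤) :
    A.card + Nat.card H ≤ (hull A H).card := by
  by_contra! hcon
  obtain ⟨y, hy, h, hh, hyh⟩ := hap H hbot
  refine hyh (nsmul_periodic_of_card_lt hgen hn htop (fun b hb c hc hbc => ?_) hy hh)
  have := card_inter_coset_add_le A hb hc hbc
  omega

end Basic

section Atoms

/-- Distinct translates of `S` meet in at most one point. -/
def IsSidon [DecidableEq G] (S : Finset G) : Prop :=
  ∀ g : G, g ≠ 0 → (S ∩ (g +ᵥ S)).card ≤ 1

theorem card_vadd_inter_vadd [DecidableEq G] {S : Finset G} (hS : IsSidon S) {x y : G}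
    (hxy : x ≠ y) : ((x +ᵥ S) ∩ (y +ᵥ S)).card ≤ 1 := by
  have h := hS (y - x) (sub_ne_zero.2 hxy.symm)
  rw [← Finset.card_vadd_finset x, Finset.vadd_finset_inter, vadd_vadd] at h
  simpa using h

theorem vadd_subset_add [DecidableEq G] {x : G} {X : Finset G} (hx : x ∈ X) (S : Finset G) :
    x +ᵥ S ⊆ X + S := by
  intro z hz
  rw [mem_vadd_iff_sub] at hz
  exact Finset.mem_add.2 ⟨x, hx, z - x, hz, by simp⟩

theorem IsSidon.two_mul_card_le [DecidableEq G] {S X : Finset G} (hS : IsSidon S)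
    (hX : 2 ≤ X.card) : 2 * S.card ≤ (X + S).card + 1 := by
  obtain ⟨x, hx, y, hy, hxy⟩ := Finset.one_lt_card.1 hX
  have h1 := Finset.card_le_card
    (Finset.union_subset (vadd_subset_add hx S) (vadd_subset_add hy S))
  have h2 := Finset.card_union_add_card_inter (x +ᵥ S) (y +ᵥ S)
  have h3 := card_vadd_inter_vadd hS hxy
  rw [Finset.card_vadd_finset, Finset.card_vadd_finset] at h2
  omega

theorem IsSidon.three_mul_card_le [DecidableEq G] {S X : Finset G} (hS : IsSidon S)
    (hX : 3 ≤ X.card) : 3 * S.card ≤ (X + S).card + 3 := by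
  obtain ⟨x, y, z, hx, hy, hz, hxy, hxz, hyz⟩ := Finset.two_lt_card_iff.1 hX
  have h1 := Finset.card_le_card
    (Finset.union_subset (Finset.union_subset (vadd_subset_add hx S) (vadd_subset_add hy S))
      (vadd_subset_add hz S))
  have h2 := Finset.card_union_add_card_inter (x +ᵥ S) (y +ᵥ S)
  have h3 := card_vadd_inter_vadd hS hxy
  have h4 := Finset.card_union_add_card_inter ((x +ᵥ S) ∪ (y +ᵥ S)) (z +ᵥ S)
  have h5 := card_vadd_inter_vadd hS hxz
  have h6 := card_vadd_inter_vadd hS hyz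
  rw [Finset.union_inter_distrib_right] at h4
  have h7 := Finset.card_union_le ((x +ᵥ S) ∩ (z +ᵥ S)) ((y +ᵥ S) ∩ (z +ᵥ S))
  simp only [Finset.card_vadd_finset] at h2 h4
  omega

theorem IsSidon.vadd [DecidableEq G] {S : Finset G} (hS : IsSidon S) (x : G) :
    IsSidon (x +ᵥ S) := by
  intro g hg
  rw [vadd_vadd]
  exact card_vadd_inter_vadd hS (by simpa using hg)

theorem vadd_add_card [DecidableEq G] (g : G) (X B : Finset G) :
    ((g +ᵥ X) + B).card = (X + B).card := by
  rw [vadd_add_assoc, Finset.card_vadd_finset]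

variable [Finite G]

/-- `M` is a `2`-atom of `B` in the subgroup `L`: among the subsets `X` of `L` with at least two
elements for which `X + B` misses at least two elements of `L`, it minimizes first
`|X + B| - |X|` and then `|X|`. -/
structure IsAtom [DecidableEq G] (L : AddSubgroup G) (B M : Finset G) : Prop where
  mem : ∀ x ∈ M, x ∈ L
  two_le : 2 ≤ M.card
  add_two_le : (M + B).card + 2 ≤ Nat.card L
  le : ∀ X : Finset G, (∀ x ∈ X, x ∈ L) → 2 ≤ X.card → (X + B).card + 2 ≤ Nat.card L →
    (M + B).card + X.card ≤ (X + B).card + M.card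
  card_le : ∀ X : Finset G, (∀ x ∈ X, x ∈ L) → 2 ≤ X.card → (X + B).card + 2 ≤ Nat.card L →
    (X + B).card + M.card ≤ (M + B).card + X.card → M.card ≤ X.card

theorem exists_isAtom [DecidableEq G] {L : AddSubgroup G} {B X : Finset G} (hB : B.Nonempty)
    (hX : ∀ x ∈ X, x ∈ L) (hX2 : 2 ≤ X.card) (hXB : (X + B).card + 2 ≤ Nat.card L) :
    ∃ M, IsAtom L B M := by
  classical
  have := Fintype.ofFinite G
  let F : Finset (Finset G) := Finset.univ.filter fun X =>
    (∀ x ∈ X, x ∈ L) ∧ 2 ≤ X.card ∧ (X + B).card + 2 ≤ Nat.card L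
  obtain ⟨M, hM, hmin⟩ := F.exists_min_image
    (fun X => toLex ((X + B).card - X.card, X.card))
    ⟨X, Finset.mem_filter.2 ⟨Finset.mem_univ _, hX, hX2, hXB⟩⟩
  simp only [F, Finset.mem_filter, Finset.mem_univ, true_and] at hM hmin
  refine ⟨M, hM.1, hM.2.1, hM.2.2, fun Y h1 h2 h3 => ?_, fun Y h1 h2 h3 h4 => ?_⟩
  · have h := hmin Y ⟨h1, h2, h3⟩
    have hY := Finset.card_le_card_add_right (s := Y) hB
    have hM' := Finset.card_le_card_add_right (s := M) hB
    rw [Prod.Lex.le_iff] at h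
    simp only [ofLex_toLex] at h
    omega
  · have h := hmin Y ⟨h1, h2, h3⟩
    have hY := Finset.card_le_card_add_right (s := Y) hB
    have hM' := Finset.card_le_card_add_right (s := M) hB
    rw [Prod.Lex.le_iff] at h
    simp only [ofLex_toLex] at h
    omega

omit [Finite G] in
theorem IsAtom.vadd [DecidableEq G] {L : AddSubgroup G} {B M : Finset G} (h : IsAtom L B M)
    {g : G} (hg : g ∈ L) : IsAtom L B (g +ᵥ M) := by
  refine ⟨fun x hx => ?_, ?_, ?_, ?_, ?_⟩
  · have := L.add_mem (h.mem _ (mem_vadd_iff_sub.1 hx)) hg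
    simpa using this
  · rw [Finset.card_vadd_finset]
    exact h.two_le
  · rw [vadd_add_card]
    exact h.add_two_le
  · rw [vadd_add_card, Finset.card_vadd_finset]
    exact h.le
  · rw [vadd_add_card, Finset.card_vadd_finset]
    exact h.card_le

theorem IsAtom.two_mul_card_add_le [DecidableEq G] {L : AddSubgroup G} {B M : Finset G}
    (h : IsAtom L B M) (hB : ∀ b ∈ B, b ∈ L) (hBne : B.Nonempty) :
    M.card + (M + B).card ≤ Nat.card L := by
  have hMB : M + B ⊆ coset L 0 := by
    intro x hx
    obtain ⟨m, hm, b, hb, rfl⟩ := Finset.mem_add.1 hx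
    simpa using L.add_mem (h.mem m hm) (hB b hb)
  have hM : M ⊆ coset L 0 := fun x hx => by simpa using h.mem x hx
  let D : Finset G := -(coset L 0 \ (M + B))
  have hD : D.card = Nat.card L - (M + B).card := by
    rw [Finset.card_neg, Finset.card_sdiff_of_subset hMB, card_coset]
  have hDB : D + B ⊆ -(coset L 0 \ M) := by
    intro x hx
    obtain ⟨d, hd, b, hb, rfl⟩ := Finset.mem_add.1 hx
    rw [Finset.mem_neg'] at hd ⊢
    rw [Finset.mem_sdiff] at hd ⊢
    obtain ⟨hd1, hd2⟩ := hd
    refine ⟨?_, fun hm => hd2 ?_⟩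
    · simp only [mem_coset, sub_zero] at hd1 ⊢
      have := L.sub_mem hd1 (hB b hb)
      convert this using 1
      abel
    · exact Finset.mem_add.2 ⟨_, hm, b, hb, by abel⟩
  have hDBc : (D + B).card ≤ Nat.card L - M.card := by
    refine (Finset.card_le_card hDB).trans ?_
    rw [Finset.card_neg, Finset.card_sdiff_of_subset hM, card_coset]
  have h1 := h.two_le
  have h2 := h.add_two_le
  have h3 := Finset.card_le_card_add_right (s := M) hBne
  have hDL : ∀ x ∈ D, x ∈ L := by
    intro x hx
    rw [Finset.mem_neg', Finset.mem_sdiff, mem_coset] at hx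
    simpa using hx.1
  have h4 := h.card_le D hDL (by omega) (by omega) (by omega)
  omega

theorem IsAtom.card_inter_vadd_le [DecidableEq G] {L : AddSubgroup G} {B M : Finset G}
    (h : IsAtom L B M) (hB : ∀ b ∈ B, b ∈ L) (hBne : B.Nonempty) {g : G} (hg : g ∈ L)
    (hne : g +ᵥ M ≠ M) : (M ∩ (g +ᵥ M)).card ≤ 1 := by
  by_contra! hcon
  have hM' := h.vadd hg
  have hcM : (g +ᵥ M).card = M.card := Finset.card_vadd_finset g M
  have hlt : (M ∩ (g +ᵥ M)).card < M.card := by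
    refine Finset.card_lt_card ⟨Finset.inter_subset_left, fun hsub => hne ?_⟩
    exact (Finset.eq_of_subset_of_card_le (fun x hx => (Finset.mem_inter.1 (hsub hx)).2)
      hcM.le).symm
  have hIB : M ∩ (g +ᵥ M) + B ⊆ (M + B) ∩ ((g +ᵥ M) + B) := Finset.subset_inter
    (Finset.add_subset_add_right Finset.inter_subset_left)
    (Finset.add_subset_add_right Finset.inter_subset_right)
  have h1 := Finset.card_le_card hIB
  have h2 := Finset.card_union_add_card_inter (M + B) ((g +ᵥ M) + B)
  have h3 := Finset.card_union_add_card_inter M (g +ᵥ M)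
  rw [← Finset.union_add, vadd_add_card] at h2
  have h4 := Finset.card_le_card ((Finset.inter_subset_left).trans' hIB)
  have h5 := h.add_two_le
  have h6 := h.two_mul_card_add_le hB hBne
  have hIL : ∀ x ∈ M ∩ (g +ᵥ M), x ∈ L := fun x hx => h.mem x (Finset.mem_inter.1 hx).1
  have h7 := mt (h.card_le _ hIL (by omega) (by omega)) (by omega)
  have hUL : ∀ x ∈ M ∪ (g +ᵥ M), x ∈ L := fun x hx =>
    (Finset.mem_union.1 hx).elim (h.mem x) (hM'.mem x)
  by_cases h8 : (M ∪ (g +ᵥ M) + B).card + 2 ≤ Nat.card L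
  · have h9 := h.le _ hUL (by omega) h8
    omega
  · omega

/-- A `2`-atom is a Sidon set or a coset of a subgroup. -/
theorem IsAtom.isSidon_or_coset [DecidableEq G] {L : AddSubgroup G} {B M : Finset G}
    (h : IsAtom L B M) (hB : ∀ b ∈ B, b ∈ L) (hBne : B.Nonempty) :
    IsSidon M ∨ ∃ (H : AddSubgroup G) (b : G), M = coset H b := by
  by_cases hs : ∃ g : G, g ≠ 0 ∧ g +ᵥ M = M
  · right
    obtain ⟨g, hg0, hg⟩ := hs
    have hgM : ∀ x ∈ M, x + g ∈ M := by
      intro x hx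
      rw [← hg, mem_vadd_iff_sub]
      simpa using hx
    have hstab : ∀ x ∈ M, ∀ y ∈ M, (x - y) +ᵥ M = M := by
      intro x hx y hy
      by_contra hne
      have h1 := h.card_inter_vadd_le hB hBne (L.sub_mem (h.mem x hx) (h.mem y hy)) hne
      have h2 := Finset.card_le_one.1 h1 x (by
        rw [Finset.mem_inter, mem_vadd_iff_sub]
        exact ⟨hx, by simpa using hy⟩) (x + g) (by
        rw [Finset.mem_inter, mem_vadd_iff_sub]
        refine ⟨hgM x hx, ?_⟩
        have := hgM y hy
        convert this using 1
        abel)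
      exact hg0 (by simpa using h2)
    obtain ⟨b, hb⟩ : M.Nonempty := Finset.card_pos.1 (by have := h.two_le; omega)
    refine ⟨AddAction.stabilizer G M, b, ?_⟩
    ext x
    rw [mem_coset, AddAction.mem_stabilizer_iff]
    refine ⟨fun hx => hstab x hx b hb, fun hx => ?_⟩
    rw [← hx, mem_vadd_iff_sub]
    simpa using hb
  · left
    intro g hg
    by_cases hgL : g ∈ L
    · exact h.card_inter_vadd_le hB hBne hgL fun h1 => hs ⟨g, hg, h1⟩
    · have : M ∩ (g +ᵥ M) = ∅ := by
        rw [Finset.eq_empty_iff_forall_notMem]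
        intro x hx
        rw [Finset.mem_inter, mem_vadd_iff_sub] at hx
        apply hgL
        have := L.sub_mem (h.mem x hx.1) (h.mem _ hx.2)
        simpa using this
      simp [this]

end Atoms

section AtomSize

variable [Finite G] [DecidableEq G]

theorem card_add_inter_coset_add_le (X : Finset G) {M : Finset G} {L : AddSubgroup G}
    (hM : ∀ x ∈ M, x ∈ L) (a : G) :
    ((X ∩ coset L a) + M).card + ((X \ coset L a) + M).card ≤ (X + M).card := by
  rw [← Finset.card_union_of_disjoint]
  · exact Finset.card_le_card (Finset.union_subset
      (Finset.add_subset_add_right Finset.inter_subset_left)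
      (Finset.add_subset_add_right Finset.sdiff_subset))
  · rw [Finset.disjoint_left]
    intro z hz hz'
    obtain ⟨x, hx, m, hm, rfl⟩ := Finset.mem_add.1 hz
    obtain ⟨x', hx', m', hm', h⟩ := Finset.mem_add.1 hz'
    rw [Finset.mem_inter, mem_coset] at hx
    rw [Finset.mem_sdiff, mem_coset] at hx'
    apply hx'.2
    have h1 : x' = x + m - m' := by rw [← h]; abel
    rw [h1]
    have := L.sub_mem (L.add_mem hx.2 (hM m hm)) (hM m' hm')
    convert this using 1
    abel

omit [Finite G] in
theorem IsAtom.erase_add {A M : Finset G} (hM : IsAtom ⊤ A M) (h3 : 3 ≤ M.card) {y : G}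
    (hy : y ∈ M) : M.erase y + A = M + A := by
  have hsub : M.erase y + A ⊆ M + A := Finset.add_subset_add_right (Finset.erase_subset y M)
  have hc := Finset.card_le_card hsub
  have he := Finset.card_erase_of_mem hy
  have h1 := hM.add_two_le
  have h2 := mt (hM.card_le (M.erase y) (by simp) (by omega) (by omega)) (by omega)
  exact Finset.eq_of_subset_of_card_le hsub (by omega)

theorem IsAtom.two_le_card_inter_coset {A M : Finset G} (hM : IsAtom ⊤ A M) (h3 : 3 ≤ M.card)
    {L : AddSubgroup G} (hML : ∀ x ∈ M, x ∈ L) {a : G} (ha : a ∈ A) :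
    2 ≤ (A ∩ coset L a).card := by
  obtain ⟨y, hy⟩ : M.Nonempty := Finset.card_pos.1 (by omega)
  have h1 : y + a ∈ M.erase y + A := by
    rw [hM.erase_add h3 hy]
    exact Finset.add_mem_add hy ha
  obtain ⟨y', hy', a', ha', h⟩ := Finset.mem_add.1 h1
  rw [Finset.mem_erase] at hy'
  have h2 : a' - a = y - y' := by
    rw [sub_eq_sub_iff_add_eq_add, add_comm a', h]
  refine Finset.one_lt_card.2 ⟨a, by simp [ha], a', ?_, ?_⟩
  · rw [Finset.mem_inter, mem_coset, h2]
    exact ⟨ha', L.sub_mem (hML y hy) (hML y' hy'.2)⟩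
  · rintro rfl
    rw [sub_self, eq_comm, sub_eq_zero] at h2
    exact hy'.1 h2.symm

theorem IsAtom.exists_inter_coset {A M : Finset G} {ε : ℕ}
    (hole : ∀ L : AddSubgroup G, L ≠ ⊥ → L ≠ ⊤ → A.card + Nat.card L ≤ (hull A L).card)
    (hA : A.Nonempty) (hM : IsAtom ⊤ A M) (h0 : (0 : G) ∈ M) (hS : IsSidon M)
    (hc : (M + A).card + 1 ≤ A.card + M.card + ε) (h3 : 3 + ε ≤ M.card)
    {L : AddSubgroup G} (hML : ∀ x ∈ M, x ∈ L) :
    ∃ a ∈ A, ((A ∩ coset L a) + M).card + 2 ≤ Nat.card L ∧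
      ((A ∩ coset L a) + M).card + 1 ≤ (A ∩ coset L a).card + M.card + ε := by
  have hMne : M.Nonempty := ⟨0, h0⟩
  by_cases htop : L = ⊤
  · subst htop
    obtain ⟨a, ha⟩ := hA
    have h1 : A ∩ coset ⊤ a = A := Finset.inter_eq_left.2 fun x _ => by simp
    rw [add_comm M A] at hc
    have h2 := hM.add_two_le
    rw [add_comm M A] at h2
    exact ⟨a, ha, by rwa [h1], by rwa [h1]⟩
  obtain ⟨g, hg, hg0⟩ : ∃ g ∈ M, g ≠ 0 := by
    obtain ⟨g, hg, hg0⟩ := Finset.exists_mem_ne (s := M) (by omega) 0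
    exact ⟨g, hg, hg0⟩
  have hbot : L ≠ ⊥ := fun h => hg0 (by simpa [h] using hML g hg)
  by_contra! hcon
  have hsplit : ∀ X : Finset G, ∀ a, (X ∩ coset L a).card + (X \ coset L a).card = X.card := by
    intro X a
    have := Finset.card_sdiff_add_card_inter X (coset L a)
    omega
  rw [add_comm M A] at hc
  have hbig : ∀ a ∈ A, Nat.card L ≤ ((A ∩ coset L a) + M).card + 1 := by
    intro a ha
    by_contra! hlt
    have h1 := hcon a ha (by omega)
    have h2 := card_add_inter_coset_add_le A hML a
    have h4 := hsplit A a
    have h5 := Finset.card_le_card_add_right (s := A \ coset L a) hMne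
    omega
  have hcos : ∀ a, (A ∩ coset L a) + M ⊆ coset L a := by
    intro a z hz
    obtain ⟨x, hx, m, hm, rfl⟩ := Finset.mem_add.1 hz
    rw [Finset.mem_inter, mem_coset] at hx
    rw [mem_coset]
    have := L.add_mem hx.2 (hML m hm)
    convert this using 1
    abel
  have hsmall : ∀ a z, z - a ∈ L → z ∉ A + M → (A ∩ coset L a).card + M.card ≤ Nat.card L := by
    intro a z hz hzn
    have hd : Disjoint (A ∩ coset L a) (M.image fun m => z - m) := by
      rw [Finset.disjoint_left]
      intro x hx hx'
      obtain ⟨m, hm, rfl⟩ := Finset.mem_image.1 hx'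
      exact hzn (Finset.mem_add.2 ⟨z - m, (Finset.mem_inter.1 hx).1, m, hm, by simp⟩)
    have hs : (M.image fun m => z - m) ⊆ coset L a := by
      intro x hx
      obtain ⟨m, hm, rfl⟩ := Finset.mem_image.1 hx
      rw [mem_coset]
      have := L.sub_mem hz (hML m hm)
      convert this using 1
      abel
    have h1 := Finset.card_le_card (Finset.union_subset (Finset.inter_subset_right (s₁ := A)) hs)
    rw [Finset.card_union_of_disjoint hd, card_coset,
      Finset.card_image_of_injective _ fun a b h => by simpa using h] at h1
    exact h1
  have hone : (hull A L \ (A + M)).card ≤ 1 := by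
    rw [Finset.card_le_one]
    intro z hz w hw
    rw [Finset.mem_sdiff, mem_hull] at hz hw
    obtain ⟨⟨a, ha, hza⟩, hz⟩ := hz
    obtain ⟨⟨b, hb, hwb⟩, hw⟩ := hw
    by_cases hab : b - a ∈ L
    · by_contra hzw
      have hwa : w - a ∈ L := by
        have := L.add_mem hwb hab
        simpa using this
      have h1 : ({z, w} : Finset G) ∪ ((A ∩ coset L a) + M) ⊆ coset L a := by
        refine Finset.union_subset ?_ (hcos a)
        intro x hx
        rw [Finset.mem_insert, Finset.mem_singleton] at hx
        rcases hx with rfl | rfl <;> simpa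
      have hsubA : (A ∩ coset L a) + M ⊆ A + M :=
        Finset.add_subset_add_right Finset.inter_subset_left
      have hd : Disjoint ({z, w} : Finset G) ((A ∩ coset L a) + M) := by
        rw [Finset.disjoint_left]
        intro x hx hx'
        rw [Finset.mem_insert, Finset.mem_singleton] at hx
        rcases hx with rfl | rfl
        · exact hz (hsubA hx')
        · exact hw (hsubA hx')
      have h2 := Finset.card_le_card h1
      rw [Finset.card_union_of_disjoint hd, card_coset, Finset.card_pair hzw] at h2
      have := hbig a ha
      omega
    · exfalso
      have h1 := hsmall a z hza hz
      have h2 := hsmall b w hwb hw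
      have h4 := hbig a ha
      have h5 := hbig b hb
      have h6 := card_add_inter_coset_add_le A hML a
      have h7 := card_add_inter_coset_add_le (A \ coset L a) hML b
      have h8 : (A \ coset L a) ∩ coset L b = A ∩ coset L b := by
        rw [Finset.sdiff_inter_right_comm, Finset.sdiff_eq_self_iff_disjoint]
        exact (disjoint_coset hab).mono_left Finset.inter_subset_right
      have h9 := hsplit A a
      have h10 := hsplit (A \ coset L a) b
      have h11 := Finset.card_le_card_add_right (s := (A \ coset L a) \ coset L b) hMne
      rw [h8] at h7 h10
      omega
  have h1 := hole L hbot htop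
  have h2 : (hull A L).card ≤ (A + M).card + 1 := by
    have := Finset.card_le_card_sdiff_add_card (s := hull A L) (t := A + M)
    omega
  have h4 : M ∪ (g +ᵥ M) ⊆ coset L 0 := by
    intro x hx
    rw [Finset.mem_union, mem_vadd_iff_sub] at hx
    rw [mem_coset, sub_zero]
    rcases hx with hx | hx
    · exact hML x hx
    · have := L.add_mem (hML _ hx) (hML g hg)
      simpa using this
  have h5 := Finset.card_le_card h4
  have h6 := Finset.card_union_add_card_inter M (g +ᵥ M)
  have h7 := hS g hg0
  rw [Finset.card_vadd_finset] at h6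
  rw [card_coset] at h5
  omega

theorem IsAtom.card_le_of_zero_mem {A M : Finset G} {ε : ℕ} (hε : ε ≤ 1)
    (hole : ∀ L : AddSubgroup G, L ≠ ⊥ → L ≠ ⊤ → A.card + Nat.card L ≤ (hull A L).card)
    (hA : A.Nonempty) (hM : IsAtom ⊤ A M) (h0 : (0 : G) ∈ M) (hS : IsSidon M)
    (hc : (M + A).card + 1 ≤ A.card + M.card + ε) : M.card ≤ 2 + ε := by
  by_contra! h3
  have hMne : M.Nonempty := ⟨0, h0⟩
  have hML : ∀ x ∈ M, x ∈ AddSubgroup.closure (M : Set G) := fun x hx =>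
    AddSubgroup.subset_closure hx
  obtain ⟨a, ha, h1, h2⟩ := hM.exists_inter_coset hole hA h0 hS hc (by omega) hML
  have h4 := hM.two_le_card_inter_coset (by omega) hML ha
  set L := AddSubgroup.closure (M : Set G) with hL
  set X := A ∩ coset L a with hX
  have hXL : ∀ x ∈ (-a) +ᵥ X, x ∈ L := by
    intro x hx
    rw [mem_vadd_iff_sub, hX, Finset.mem_inter, mem_coset] at hx
    simpa using hx.2
  obtain ⟨N, hN⟩ := exists_isAtom (L := L) (B := M) (X := (-a) +ᵥ X) hMne hXL
    (by rwa [Finset.card_vadd_finset]) (by rwa [vadd_add_card])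
  have h5 := hN.le _ hXL (by rwa [Finset.card_vadd_finset]) (by rwa [vadd_add_card])
  rw [vadd_add_card, Finset.card_vadd_finset] at h5
  have h6 := hN.two_le
  have h7 := hS.two_mul_card_le h6
  by_cases h8 : N.card = 2
  · omega
  have h9 := hS.three_mul_card_le (X := N) (by omega)
  rcases hN.isSidon_or_coset hML hMne with hNS | ⟨K, b, rfl⟩
  · have h10 := hNS.three_mul_card_le (X := M) (by omega)
    rw [add_comm M N] at h10
    omega
  · rw [card_coset] at *
    have h10 : ∃ m ∈ M, m ∉ K := by
      by_contra! hall
      have hLK : L ≤ K := (AddSubgroup.closure_le K).2 hall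
      have h11 := AddSubgroup.card_le_of_le hLK
      have h12 := hN.add_two_le
      have h13 := Finset.card_le_card_add_right (s := coset K b) hMne
      rw [card_coset] at h13
      omega
    obtain ⟨m, hm, hmK⟩ := h10
    have h11 : coset K b ∪ coset K (b + m) ⊆ coset K b + M := by
      refine Finset.union_subset (fun x hx => ?_) fun x hx => ?_
      · exact Finset.mem_add.2 ⟨x, hx, 0, h0, by simp⟩
      · refine Finset.mem_add.2 ⟨x - m, ?_, m, hm, by simp⟩
        rw [mem_coset] at hx ⊢
        convert hx using 1
        abel
    have h12 := Finset.card_le_card h11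
    rw [Finset.card_union_of_disjoint (disjoint_coset (by simpa using hmK)), card_coset,
      card_coset] at h12
    omega

theorem IsAtom.card_le_two_add {A M : Finset G} {ε : ℕ} (hε : ε ≤ 1)
    (hole : ∀ L : AddSubgroup G, L ≠ ⊥ → L ≠ ⊤ → A.card + Nat.card L ≤ (hull A L).card)
    (hA : A.Nonempty) (hM : IsAtom ⊤ A M) (hS : IsSidon M)
    (hc : (M + A).card + 1 ≤ A.card + M.card + ε) : M.card ≤ 2 + ε := by
  obtain ⟨y, hy⟩ : M.Nonempty := Finset.card_pos.1 (by have := hM.two_le; omega)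
  have h := (hM.vadd (g := -y) (by simp)).card_le_of_zero_mem hε hole hA
    (by rw [mem_vadd_iff_sub]; simpa using hy) (hS.vadd _)
    (by rwa [vadd_add_card, Finset.card_vadd_finset])
  rwa [Finset.card_vadd_finset] at h

end AtomSize

section Growth

variable [DecidableEq G]

theorem eq_univ_of_stabilizer_eq_top [Fintype G] {X : Finset G} (hX : X.Nonempty)
    (h : AddAction.stabilizer G X = ⊤) : X = Finset.univ := by
  obtain ⟨x, hx⟩ := hX
  rw [Finset.eq_univ_iff_forall]
  intro y
  have h1 : y - x ∈ AddAction.stabilizer G X := h ▸ AddSubgroup.mem_top _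
  rw [AddAction.mem_stabilizer_iff] at h1
  rw [← h1, mem_vadd_iff_sub]
  simpa using hx

theorem add_eq_univ_of_card_le [Fintype G] {A X : Finset G}
    (hgen : AddSubgroup.closure ((A : Set G) - (A : Set G)) = ⊤) (hX : X.Nonempty)
    (hc : (X + A).card ≤ X.card) : X = Finset.univ := by
  have h1 : ∀ a ∈ A, a +ᵥ X = X + A := by
    intro a ha
    refine Finset.eq_of_subset_of_card_le ?_ (by rwa [Finset.card_vadd_finset])
    rw [add_comm X A]
    exact vadd_subset_add ha X
  refine eq_univ_of_stabilizer_eq_top hX ?_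
  rw [eq_top_iff, ← hgen, AddSubgroup.closure_le]
  rintro _ ⟨a, ha, b, hb, rfl⟩
  simp only [SetLike.mem_coe, AddAction.mem_stabilizer_iff]
  rw [sub_eq_neg_add, ← vadd_vadd, h1 a ha, ← h1 b hb, neg_vadd_vadd]

theorem min_card_le_card_nsmul [Fintype G] {A : Finset G} (hA : A.Nonempty)
    (hgen : AddSubgroup.closure ((A : Set G) - (A : Set G)) = ⊤) (j : ℕ) :
    min (Fintype.card G) j ≤ (j • A).card := by
  induction j with
  | zero => simp
  | succ j ih =>
    have h1 := Finset.card_le_card_add_right (s := j • A) hA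
    rw [nsmul_succ_eq]
    by_cases h2 : (j • A + A).card ≤ (j • A).card
    · have h3 := add_eq_univ_of_card_le hgen (nsmul_nonempty hA j) h2
      have h4 := congrArg Finset.card h3
      rw [Finset.card_univ] at h4
      omega
    · omega

omit [DecidableEq G] in
theorem zmultiples_ne_top [Fintype G] {n : ℕ} (hn : AddMonoid.exponent G + 1 ≤ n)
    (hG : n ≤ Fintype.card G) (d : G) : AddSubgroup.zmultiples d ≠ ⊤ := by
  intro h
  have h1 := Nat.card_zmultiples d
  rw [h, AddSubgroup.card_top, Nat.card_eq_fintype_card] at h1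
  have h2 := Nat.le_of_dvd (AddMonoid.exponent_pos.2 AddMonoid.ExponentExists.of_finite)
    (AddMonoid.addOrder_dvd_exponent d)
  omega

/-- If `A` meets at most two cosets of `H`, the index of `H` is bounded by the order of the
difference of these cosets. -/
theorem card_le_mul_of_subset_union [Finite G] {A : Finset G}
    (hgen : AddSubgroup.closure ((A : Set G) - (A : Set G)) = ⊤) {H : AddSubgroup G} {b c : G}
    (hA : ∀ a ∈ A, a - b ∈ H ∨ a - c ∈ H) {j : ℕ} (hj : 0 < j) (h : j • (b - c) ∈ H) :
    Nat.card G ≤ j * Nat.card H := by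
  classical
  have := Fintype.ofFinite G
  have htop : H ⊔ AddSubgroup.zmultiples (b - c) = ⊤ := by
    have hc : ∀ a ∈ A, a - c ∈ H ⊔ AddSubgroup.zmultiples (b - c) := by
      intro a ha
      rcases hA a ha with h | h
      · have := AddSubgroup.add_mem_sup h (AddSubgroup.mem_zmultiples (b - c))
        simpa using this
      · exact AddSubgroup.mem_sup_left h
    rw [eq_top_iff, ← hgen, AddSubgroup.closure_le]
    rintro _ ⟨x, hx, y, hy, rfl⟩
    have := sub_mem (hc x hx) (hc y hy)
    simpa using this
  have hcov : (Finset.univ : Finset G) ⊆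
      (Finset.range j).biUnion fun i => coset H (i • (b - c)) := by
    intro g _
    have hg : g ∈ H ⊔ AddSubgroup.zmultiples (b - c) := htop ▸ AddSubgroup.mem_top g
    obtain ⟨x, hx, y, hy, rfl⟩ := AddSubgroup.mem_sup.1 hg
    obtain ⟨z, rfl⟩ := AddSubgroup.mem_zmultiples_iff.1 hy
    have hj' : (0 : ℤ) < j := by exact_mod_cast hj
    have h0 := Int.emod_nonneg z hj'.ne'
    have h1 := Int.emod_lt_of_pos z hj'
    obtain ⟨i, hi⟩ := Int.eq_ofNat_of_zero_le h0
    simp only [Finset.mem_biUnion, Finset.mem_range, mem_coset]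
    refine ⟨i, by omega, ?_⟩
    have h2 : z • (b - c) = (z / j) • (j • (b - c)) + i • (b - c) := by
      rw [← natCast_zsmul (b - c) j, smul_smul, ← natCast_zsmul (b - c) i, ← add_smul]
      congr 1
      have := Int.mul_ediv_add_emod z j
      rw [hi] at this
      linarith [mul_comm (j : ℤ) (z / j)]
    rw [h2, ← add_assoc, add_sub_cancel_right]
    exact H.add_mem hx (H.zsmul_mem h _)
  have h1 := (Finset.card_le_card hcov).trans Finset.card_biUnion_le
  simp only [card_coset, Finset.sum_const, Finset.card_range, smul_eq_mul] at h1
  rwa [Finset.card_univ, ← Nat.card_eq_fintype_card] at h1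

end Growth

section Arcs

variable [DecidableEq G]

/-- The elements of `A` whose translate by `d` leaves `A`. -/
def boundary (A : Finset G) (d : G) : Finset G := A.filter fun a => a + d ∉ A

theorem mem_boundary {A : Finset G} {d a : G} : a ∈ boundary A d ↔ a ∈ A ∧ a + d ∉ A := by
  simp [boundary]

theorem card_pair_add (A : Finset G) (x d : G) :
    (({x, x + d} : Finset G) + A).card = A.card + (boundary A d).card := by
  have h1 : ({x, x + d} : Finset G) + A = x +ᵥ (A ∪ (d +ᵥ boundary A d)) := by
    ext z
    rw [mem_vadd_iff_sub, Finset.mem_union, mem_vadd_iff_sub, mem_boundary]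
    constructor
    · intro hz
      obtain ⟨y, hy, a, ha, rfl⟩ := Finset.mem_add.1 hz
      simp only [Finset.mem_insert, Finset.mem_singleton] at hy
      rcases hy with rfl | rfl
      · left; simpa using ha
      · by_cases h : a + d ∈ A
        · left
          convert h using 1
          abel
        · right
          have h2 : x + d + a - x - d = a := by abel
          rw [h2]
          exact ⟨ha, h⟩
    · rintro (h | ⟨h, -⟩)
      · exact Finset.mem_add.2 ⟨x, by simp, _, h, by simp⟩
      · refine Finset.mem_add.2 ⟨x + d, by simp, _, h, ?_⟩
        abel
  rw [h1, Finset.card_vadd_finset, Finset.card_union_of_disjoint, Finset.card_vadd_finset]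
  rw [Finset.disjoint_left]
  intro z hz hz'
  rw [mem_vadd_iff_sub, mem_boundary] at hz'
  exact hz'.2 (by simpa using hz)

variable [Finite G]

theorem exists_mem_boundary {A : Finset G} {d b z : G} (hb : b ∈ A)
    (hz : z - b ∈ AddSubgroup.zmultiples d) (hzA : z ∉ A) :
    ∃ e ∈ boundary A d, e - b ∈ AddSubgroup.zmultiples d := by
  rw [mem_zmultiples_iff_mem_range_addOrderOf] at hz
  by_contra! hcon
  have h1 : ∀ i : ℕ, b + i • d ∈ A := by
    intro i
    induction i with
    | zero => simpa
    | succ i ih =>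
      by_contra h
      refine hcon (b + i • d) (mem_boundary.2 ⟨ih, ?_⟩) ?_
      · rwa [add_assoc, ← succ_nsmul]
      · simp only [add_sub_cancel_left]
        exact AddSubgroup.nsmul_mem_zmultiples d i
  obtain ⟨i, -, hi⟩ := Finset.mem_image.1 hz
  apply hzA
  have := h1 i
  rw [hi] at this
  simpa using this

theorem card_hull_zmultiples_le (A : Finset G) (d : G) :
    (hull A (AddSubgroup.zmultiples d)).card ≤
      A.card + (boundary A d).card * (Nat.card (AddSubgroup.zmultiples d) - 1) := by
  set H := AddSubgroup.zmultiples d with hH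
  have h1 : hull A H \ A ⊆ (boundary A d).biUnion fun e => (coset H e).erase e := by
    intro z hz
    rw [Finset.mem_sdiff, mem_hull] at hz
    obtain ⟨⟨b, hb, hzb⟩, hz⟩ := hz
    obtain ⟨e, he, heb⟩ := exists_mem_boundary hb hzb hz
    simp only [Finset.mem_biUnion, Finset.mem_erase, mem_coset]
    refine ⟨e, he, ?_, ?_⟩
    · rintro rfl
      exact hz (mem_boundary.1 he).1
    · have := H.sub_mem hzb heb
      simpa using this
  have h2 := (Finset.card_le_card h1).trans Finset.card_biUnion_le
  have h3 : ∀ e ∈ boundary A d, ((coset H e).erase e).card = Nat.card H - 1 := by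
    intro e _
    rw [Finset.card_erase_of_mem (self_mem_coset H e), card_coset]
  rw [Finset.sum_congr rfl h3, Finset.sum_const, smul_eq_mul] at h2
  have h4 := Finset.card_le_card_sdiff_add_card (s := hull A H) (t := A)
  omega

/-- The arithmetic progression `e, e - d, …, e - (l - 1) d`. -/
def arc (d e : G) (l : ℕ) : Finset G := (Finset.range l).image fun i => e - i • d

omit [Finite G] in
theorem mem_arc {d e x : G} {l : ℕ} : x ∈ arc d e l ↔ ∃ i < l, e - i • d = x := by
  simp [arc]

omit [Finite G] in
theorem sub_nsmul_mem_arc {d e : G} {i l : ℕ} (h : l ≤ i) (hi : i < addOrderOf d) :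
    e - i • d ∉ arc d e l := by
  rw [mem_arc]
  rintro ⟨j, hj, h1⟩
  have h2 : j • d = i • d := by simpa using h1
  rw [nsmul_inj_mod, Nat.mod_eq_of_lt hi, Nat.mod_eq_of_lt (by omega)] at h2
  omega

omit [Finite G] in
theorem card_arc {d e : G} {l : ℕ} (h : l ≤ addOrderOf d) : (arc d e l).card = l := by
  rw [arc, Finset.card_image_of_injOn, Finset.card_range]
  intro i hi j hj h1
  simp only [Finset.coe_range, Set.mem_Iio] at hi hj
  have h2 : i • d = j • d := by simpa using h1
  rwa [nsmul_inj_mod, Nat.mod_eq_of_lt (by omega), Nat.mod_eq_of_lt (by omega)] at h2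

omit [Finite G] in
theorem arc_subset_arc_add {d e f : G} {p q : ℕ} (hp : 0 < p) (hq : 0 < q) :
    arc d (e + f) (p + q - 1) ⊆ arc d e p + arc d f q := by
  intro x hx
  obtain ⟨i, hi, rfl⟩ := mem_arc.1 hx
  obtain ⟨a, b, ha, hb, rfl⟩ : ∃ a b, a < p ∧ b < q ∧ a + b = i := by
    by_cases h : i < p
    · exact ⟨i, 0, h, hq, rfl⟩
    · exact ⟨p - 1, i - (p - 1), by omega, by omega, by omega⟩
  refine Finset.mem_add.2 ⟨_, mem_arc.2 ⟨a, ha, rfl⟩, _, mem_arc.2 ⟨b, hb, rfl⟩, ?_⟩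
  rw [add_nsmul]
  abel

omit [Finite G] in
theorem min_le_card_arc (d e : G) (l : ℕ) : min (addOrderOf d) l ≤ (arc d e l).card := by
  have h1 : arc d e (min (addOrderOf d) l) ⊆ arc d e l := by
    intro x hx
    obtain ⟨i, hi, rfl⟩ := mem_arc.1 hx
    exact mem_arc.2 ⟨i, by omega, rfl⟩
  have := Finset.card_le_card h1
  rwa [card_arc (min_le_left _ _)] at this

theorem eq_arc_of_boundary {A : Finset G} {d e : G} (he : e ∈ boundary A d)
    (huniq : ∀ e' ∈ boundary A d, e' - e ∈ AddSubgroup.zmultiples d → e' = e) :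
    ∃ l, 0 < l ∧ l < addOrderOf d ∧
      A ∩ coset (AddSubgroup.zmultiples d) e = arc d e l := by
  classical
  have he' := mem_boundary.1 he
  have hpos : 0 < addOrderOf d := addOrderOf_pos d
  have hlast : e - (addOrderOf d - 1) • d ∉ A := by
    have h1 : e - (addOrderOf d - 1) • d = e + d := by
      rw [sub_eq_iff_eq_add, add_assoc, ← succ_nsmul', Nat.sub_add_cancel hpos,
        addOrderOf_nsmul_eq_zero, add_zero]
    rw [h1]
    exact he'.2
  have hex : ∃ l, e - l • d ∉ A := ⟨_, hlast⟩
  have hl : Nat.find hex < addOrderOf d := by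
    have := Nat.find_min' hex hlast
    omega
  have hspec := Nat.find_spec hex
  have hmin : ∀ i < Nat.find hex, e - i • d ∈ A := fun i hi => not_not.1 (Nat.find_min hex hi)
  generalize Nat.find hex = l at hl hspec hmin
  have hl0 : 0 < l := by
    rcases Nat.eq_zero_or_pos l with rfl | h
    · simp only [zero_nsmul, sub_zero] at hspec
      exact absurd he'.1 hspec
    · exact h
  refine ⟨l, hl0, hl, ?_⟩
  have hout : ∀ i, l ≤ i → i < addOrderOf d → e - i • d ∉ A := by
    intro i hi
    induction i, hi using Nat.le_induction with
    | base => exact fun _ => hspec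
    | succ i hi ih =>
      intro h1 h2
      have h3 := ih (by omega)
      have h4 : e - (i + 1) • d ∈ boundary A d := by
        refine mem_boundary.2 ⟨h2, ?_⟩
        have h4 : e - (i + 1) • d + d = e - i • d := by
          rw [succ_nsmul]
          abel
        rwa [h4]
      have h5 := huniq _ h4 (by
        rw [sub_sub_cancel_left]
        exact neg_mem (AddSubgroup.nsmul_mem_zmultiples d _))
      exact h3 (by
        have h6 : (i + 1) • d = 0 := by simpa using h5
        exact absurd (addOrderOf_le_of_nsmul_eq_zero (by omega) h6) (by omega))
  ext x
  rw [Finset.mem_inter, mem_coset, mem_arc]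
  constructor
  · rintro ⟨hxA, hx⟩
    have hx' : e - x ∈ AddSubgroup.zmultiples d := by
      have := neg_mem hx
      simpa using this
    rw [mem_zmultiples_iff_mem_range_addOrderOf] at hx'
    obtain ⟨i, hi, h⟩ := Finset.mem_image.1 hx'
    rw [Finset.mem_range] at hi
    have h1 : e - i • d = x := by rw [h]; abel
    refine ⟨i, ?_, h1⟩
    by_contra! h2
    exact hout i h2 hi (h1 ▸ hxA)
  · rintro ⟨i, hi, rfl⟩
    refine ⟨hmin i hi, ?_⟩
    rw [sub_sub_cancel_left]
    exact neg_mem (AddSubgroup.nsmul_mem_zmultiples d _)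

end Arcs

section Counting

variable [DecidableEq G]

theorem card_coset_add [Finite G] (A : Finset G) (H : AddSubgroup G) (b : G) :
    (coset H b + A).card = (hull A H).card := by
  have h : coset H b + A = b +ᵥ hull A H := by
    ext z
    rw [mem_vadd_iff_sub, mem_hull]
    constructor
    · intro hz
      obtain ⟨x, hx, a, ha, rfl⟩ := Finset.mem_add.1 hz
      refine ⟨a, ha, ?_⟩
      rw [mem_coset] at hx
      convert hx using 1
      abel
    · rintro ⟨a, ha, h⟩
      refine Finset.mem_add.2 ⟨z - a, ?_, a, ha, by simp⟩
      rw [mem_coset]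
      convert h using 1
      abel
  rw [h, Finset.card_vadd_finset]

omit [DecidableEq G] in
theorem two_le_natCard [Finite G] {H : AddSubgroup G} (hH : H ≠ ⊥) : 2 ≤ Nat.card H := by
  have h0 : Nat.card H ≠ 0 := Nat.card_pos.ne'
  have h1 := mt AddSubgroup.card_eq_one.1 hH
  omega

variable [Fintype G]

omit [DecidableEq G] in
theorem card_top_eq : Nat.card (⊤ : AddSubgroup G) = Fintype.card G := by
  rw [AddSubgroup.card_top, Nat.card_eq_fintype_card]

theorem card_add_card_le_of_notMem {X Y : Finset G} {x : G} (hx : x ∉ X + Y) :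
    X.card + Y.card ≤ Fintype.card G := by
  have hd : Disjoint X (Y.image fun y => x - y) := by
    rw [Finset.disjoint_left]
    intro z hz hz'
    obtain ⟨y, hy, rfl⟩ := Finset.mem_image.1 hz'
    exact hx (Finset.mem_add.2 ⟨_, hz, y, hy, by simp⟩)
  have h := Finset.card_le_univ (X ∪ Y.image fun y => x - y)
  rwa [Finset.card_union_of_disjoint hd,
    Finset.card_image_of_injective _ fun a b h => by simpa using h] at h

variable {A : Finset G} {n : ℕ}

theorem card_add_card_le_card_add (hA : A.Nonempty) (hn : AddMonoid.exponent G + 1 ≤ n)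
    (hG : n ≤ Fintype.card G)
    (hole : ∀ L : AddSubgroup G, L ≠ ⊥ → L ≠ ⊤ → A.card + Nat.card L ≤ (hull A L).card)
    {X : Finset G} (h2 : 2 ≤ X.card) (hX : (X + A).card + 2 ≤ Fintype.card G) :
    X.card + A.card ≤ (X + A).card := by
  by_contra! hcon
  obtain ⟨M, hM⟩ := exists_isAtom (L := ⊤) hA (by simp) h2 (by rwa [card_top_eq])
  have hle := hM.le X (by simp) h2 (by rwa [card_top_eq])
  have hM2 := hM.two_le
  rcases hM.isSidon_or_coset (by simp) hA with hS | ⟨H, b, rfl⟩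
  · have h3 := hM.card_le_two_add (ε := 0) (by omega) hole hA hS (by omega)
    obtain ⟨x, y, hxy, rfl⟩ := Finset.card_eq_two.1 (le_antisymm h3 hM2)
    have h4 := card_pair_add A x (y - x)
    rw [add_sub_cancel] at h4
    have h5 := hole (AddSubgroup.zmultiples (y - x))
      (by rw [Ne, AddSubgroup.zmultiples_eq_bot]; exact sub_ne_zero.2 hxy.symm)
      (zmultiples_ne_top hn hG _)
    have h6 := card_hull_zmultiples_le A (y - x)
    have h7 : (boundary A (y - x)).card ≤ 1 := by omega
    have h8 := Nat.mul_le_mul_right (Nat.card (AddSubgroup.zmultiples (y - x)) - 1) h7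
    have h9 : 0 < Nat.card (AddSubgroup.zmultiples (y - x)) := Nat.card_pos
    omega
  · have h3 := hM.add_two_le
    have h4 := Finset.card_le_card_add_right (s := coset H b) hA
    rw [card_top_eq] at h3
    rw [card_coset_add] at hle h3 h4
    rw [card_coset] at hle hM2 h4
    have h5 := hole H (by rintro rfl; rw [AddSubgroup.card_bot] at hM2; omega)
      (by rintro rfl; rw [card_top_eq] at h4; omega)
    omega

theorem card_nsmul_add_le (hA2 : 2 ≤ A.card) (hn : AddMonoid.exponent G + 1 ≤ n)
    (hG : n ≤ Fintype.card G)
    (hole : ∀ L : AddSubgroup G, L ≠ ⊥ → L ≠ ⊤ → A.card + Nat.card L ≤ (hull A L).card)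
    {j : ℕ} (hj : 0 < j) (i : ℕ) (h : ((j + i) • A).card + 2 ≤ Fintype.card G) :
    (j • A).card + i * A.card ≤ ((j + i) • A).card := by
  have hA : A.Nonempty := Finset.card_pos.1 (by omega)
  have hpos : ∀ r, A.card ≤ ((r + 1) • A).card := by
    intro r
    rw [nsmul_succ_eq]
    exact Finset.card_le_card_add_left (nsmul_nonempty hA r)
  induction i with
  | zero => simp
  | succ i ih =>
    rw [← add_assoc, nsmul_succ_eq] at h ⊢
    have h1 := Finset.card_le_card_add_right (s := (j + i) • A) hA
    have h2 := ih (by omega)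
    obtain ⟨r, hr⟩ : ∃ r, j + i = r + 1 := ⟨j + i - 1, by omega⟩
    have h3 := hpos r
    rw [← hr] at h3
    have h4 := card_add_card_le_card_add hA hn hG hole (by omega) h
    rw [Nat.add_mul]
    omega

/-- The union of the `H`-cosets contained in `A`. -/
noncomputable def fullPart (A : Finset G) (H : AddSubgroup G) : Finset G :=
  A.filter fun x => coset H x ⊆ A

theorem mem_fullPart {H : AddSubgroup G} {x : G} :
    x ∈ fullPart A H ↔ x ∈ A ∧ coset H x ⊆ A := by
  simp [fullPart]

theorem mul_card_hull_add_le {H : AddSubgroup G}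
    (ih : min (Fintype.card G) (n * (hull A H).card) ≤ (hull (n • A) H).card)
    (hF : (fullPart A H).Nonempty) {x : G} (hx : x ∉ (n + 1) • A) :
    n * (hull A H).card + (fullPart A H).card ≤ Fintype.card G := by
  have h1 : x ∉ hull (n • A) H + fullPart A H := by
    intro h
    obtain ⟨y, hy, z, hz, rfl⟩ := Finset.mem_add.1 h
    obtain ⟨y', hy', hyy⟩ := mem_hull.1 hy
    apply hx
    rw [nsmul_succ_eq]
    refine Finset.mem_add.2 ⟨y', hy', z + (y - y'), (mem_fullPart.1 hz).2 (by simpa using hyy), ?_⟩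
    abel
  have h2 := card_add_card_le_of_notMem h1
  have h3 := hF.card_pos
  omega

end Counting

section Extremal

variable [DecidableEq G] [Fintype G] {A : Finset G} {n : ℕ}

/-- The properties of a hypothetical set `A` with `|nA| + 1 = |G| = n |A|`. -/
structure IsExtremal (A : Finset G) (n : ℕ) : Prop where
  gen : AddSubgroup.closure ((A : Set G) - (A : Set G)) = ⊤
  exponent_lt : AddMonoid.exponent G + 1 ≤ n
  four_le : 4 ≤ n
  three_le : 3 ≤ A.card
  card_eq : Fintype.card G = n * A.card
  hole : ∀ L : AddSubgroup G, L ≠ ⊥ → L ≠ ⊤ → A.card + Nat.card L ≤ (hull A L).card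
  full : ∀ L : AddSubgroup G, L ≠ ⊥ → (fullPart A L).Nonempty →
    (n - 1) * (hull A L).card + (fullPart A L).card ≤ Fintype.card G
  three_nsmul : (3 • A).card ≤ 3 * A.card

theorem IsExtremal.card_lt (hA : IsExtremal A n) {H : AddSubgroup G} {b c : G}
    (h : ∀ a ∈ A, a - b ∈ H ∨ a - c ∈ H) : A.card < Nat.card H := by
  have h1 := card_le_mul_of_subset_union hA.gen h
    (AddMonoid.exponent_pos.2 AddMonoid.ExponentExists.of_finite)
    (by rw [AddMonoid.exponent_nsmul_eq_zero]; exact H.zero_mem)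
  rw [Nat.card_eq_fintype_card, hA.card_eq] at h1
  have h2 := hA.exponent_lt
  have h3 : 0 < Nat.card H := Nat.card_pos
  by_contra! h4
  nlinarith

theorem IsExtremal.three_mul_addOrderOf_lt (hA : IsExtremal A n) (d : G) :
    3 * Nat.card (AddSubgroup.zmultiples d) < Fintype.card G := by
  have h1 := Nat.le_of_dvd (AddMonoid.exponent_pos.2 AddMonoid.ExponentExists.of_finite)
    (AddMonoid.addOrder_dvd_exponent d)
  have h2 := hA.exponent_lt
  have h3 := hA.three_le
  rw [Nat.card_zmultiples, hA.card_eq]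
  nlinarith

theorem IsExtremal.zmultiples_ne_top (hA : IsExtremal A n) (d : G) :
    AddSubgroup.zmultiples d ≠ ⊤ := by
  intro h
  have h1 := hA.three_mul_addOrderOf_lt d
  rw [h, card_top_eq] at h1
  omega

theorem IsExtremal.exists_boundary (hA : IsExtremal A n) {d : G} (hd : d ≠ 0)
    (h3 : (boundary A d).card ≤ 3) {a : G} (ha : a ∈ A) :
    ∃ e ∈ boundary A d, a - e ∈ AddSubgroup.zmultiples d := by
  set H := AddSubgroup.zmultiples d with hH
  have hbot : H ≠ ⊥ := by rwa [hH, Ne, AddSubgroup.zmultiples_eq_bot]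
  have hfull : ∀ x ∈ hull A H, x ∉ fullPart A H → ∃ e ∈ boundary A d, x - e ∈ H := by
    intro x hx hxF
    rw [mem_hull] at hx
    obtain ⟨b, hb, hxb⟩ := hx
    have h1 : ∃ z, z - b ∈ H ∧ z ∉ A := by
      by_contra! hcon
      refine hxF (mem_fullPart.2 ⟨hcon x hxb, fun z hz => hcon z ?_⟩)
      have := H.add_mem (mem_coset.1 hz) hxb
      simpa using this
    obtain ⟨z, hz, hzA⟩ := h1
    obtain ⟨e, he, heb⟩ := exists_mem_boundary hb hz hzA
    refine ⟨e, he, ?_⟩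
    have := H.sub_mem hxb heb
    simpa using this
  refine hfull a (subset_hull A H ha) fun haF => ?_
  have h4 := hA.full H hbot ⟨a, haF⟩
  have h5 := hA.hole H hbot (hA.zmultiples_ne_top d)
  have h6 : hull A H ⊆ fullPart A H ∪ (boundary A d).biUnion fun e => coset H e := by
    intro x hx
    rw [Finset.mem_union]
    by_cases hxF : x ∈ fullPart A H
    · exact Or.inl hxF
    · obtain ⟨e, he, hxe⟩ := hfull x hx hxF
      exact Or.inr (Finset.mem_biUnion.2 ⟨e, he, mem_coset.2 hxe⟩)
  have h7 := (Finset.card_le_card h6).trans (Finset.card_union_le _ _)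
  have h8 := Finset.card_biUnion_le (s := boundary A d) (t := fun e => coset H e)
  simp only [card_coset, Finset.sum_const, smul_eq_mul] at h8
  have h9 := Nat.mul_le_mul_right (Nat.card H) h3
  rw [hA.card_eq] at h4
  have h10 := hA.four_le
  have h11 : 0 < Nat.card H := Nat.card_pos
  obtain ⟨r, rfl⟩ : ∃ r, n = r + 1 := ⟨n - 1, by omega⟩
  simp only [Nat.add_sub_cancel] at h4
  have h12 := Nat.mul_le_mul_left r h5
  have h13 := Nat.mul_le_mul_right (Nat.card H) (show 3 ≤ r by omega)
  rw [Nat.add_mul] at h4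
  rw [Nat.mul_add] at h12
  omega

theorem IsExtremal.exists_boundary_pair (hA : IsExtremal A n) {d : G} (hd : d ≠ 0)
    (h3 : (boundary A d).card ≤ 3) :
    ∃ e ∈ boundary A d, ∃ f ∈ boundary A d, e - f ∉ AddSubgroup.zmultiples d := by
  obtain ⟨a, ha⟩ : A.Nonempty := Finset.card_pos.1 (by have := hA.three_le; omega)
  obtain ⟨f, hf, haf⟩ := hA.exists_boundary hd h3 ha
  obtain ⟨b, hb, hba⟩ := exists_sub_notMem hA.gen (hA.zmultiples_ne_top d) a
  obtain ⟨e, he, hbe⟩ := hA.exists_boundary hd h3 hb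
  refine ⟨e, he, f, hf, fun h => hba ?_⟩
  have := sub_mem (add_mem hbe h) haf
  simpa using this

omit [Fintype G] in
theorem arc_subset_coset [Finite G] (d e : G) (l : ℕ) :
    arc d e l ⊆ coset (AddSubgroup.zmultiples d) e := by
  intro x hx
  obtain ⟨i, -, rfl⟩ := mem_arc.1 hx
  rw [mem_coset, sub_sub_cancel_left]
  exact neg_mem (AddSubgroup.nsmul_mem_zmultiples d i)

theorem IsExtremal.two_lt_card_boundary (hA : IsExtremal A n) {d : G} (hd : d ≠ 0) :
    2 < (boundary A d).card := by
  by_contra! h2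
  obtain ⟨e, he, f, hf, hef⟩ := hA.exists_boundary_pair hd (by omega)
  have hne : e ≠ f := by
    rintro rfl
    exact hef (by simp)
  have hE : boundary A d = {e, f} := by
    symm
    refine Finset.eq_of_subset_of_card_le ?_ (by rwa [Finset.card_pair hne])
    intro x hx
    rw [Finset.mem_insert, Finset.mem_singleton] at hx
    rcases hx with rfl | rfl <;> assumption
  have hcov : ∀ a ∈ A, a - e ∈ AddSubgroup.zmultiples d ∨ a - f ∈ AddSubgroup.zmultiples d := by
    intro a ha
    obtain ⟨x, hx, hax⟩ := hA.exists_boundary hd (by omega) ha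
    rw [hE, Finset.mem_insert, Finset.mem_singleton] at hx
    rcases hx with rfl | rfl
    · exact Or.inl hax
    · exact Or.inr hax
  obtain ⟨p, hp, hph, hpA⟩ := eq_arc_of_boundary he (by
    intro x hx hxe
    rw [hE, Finset.mem_insert, Finset.mem_singleton] at hx
    rcases hx with rfl | rfl
    · rfl
    · exact absurd (by simpa using neg_mem hxe) hef)
  obtain ⟨q, hq, hqh, hqA⟩ := eq_arc_of_boundary hf (by
    intro x hx hxe
    rw [hE, Finset.mem_insert, Finset.mem_singleton] at hx
    rcases hx with rfl | rfl
    · exact absurd hxe hef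
    · rfl)
  have hk := hA.card_lt hcov
  rw [Nat.card_zmultiples] at hk
  have hAsub : A ⊆ arc d e p ∪ arc d f q := by
    intro a ha
    rw [← hpA, ← hqA]
    rcases hcov a ha with h | h
    · exact Finset.mem_union_left _ (Finset.mem_inter.2 ⟨ha, mem_coset.2 h⟩)
    · exact Finset.mem_union_right _ (Finset.mem_inter.2 ⟨ha, mem_coset.2 h⟩)
  have hpsub : arc d e p ⊆ A := hpA ▸ Finset.inter_subset_left
  have hqsub : arc d f q ⊆ A := hqA ▸ Finset.inter_subset_left
  have hAc := (Finset.card_le_card hAsub).trans (Finset.card_union_le _ _)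
  have hdisj : ∀ {x y : G} (i j : ℕ), x - y ∉ AddSubgroup.zmultiples d →
      Disjoint (arc d x i) (arc d y j) := fun i j h =>
    (disjoint_coset h).mono (arc_subset_coset d _ _) (arc_subset_coset d _ _)
  have hAd := Finset.card_le_card (Finset.union_subset hpsub hqsub)
  rw [Finset.card_union_of_disjoint (hdisj p q hef), card_arc hph.le, card_arc hqh.le] at hAd
  rw [card_arc hph.le, card_arc hqh.le] at hAc
  have hj : ∀ j, 0 < j → j ≤ 3 → j • (e - f) ∉ AddSubgroup.zmultiples d := by
    intro j hj0 hj3 hmem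
    have h1 := card_le_mul_of_subset_union hA.gen hcov hj0 hmem
    have h2 := hA.three_mul_addOrderOf_lt d
    rw [Nat.card_eq_fintype_card] at h1
    have h3 := Nat.mul_le_mul_right (Nat.card (AddSubgroup.zmultiples d)) hj3
    omega
  have hj1 : e - f ∉ AddSubgroup.zmultiples d := hef
  have hj2 := hj 2 (by omega) (by omega)
  have hj3 := hj 3 (by omega) (by omega)
  have h3A : ∀ {x y z : G} {i j l : ℕ}, 0 < i → 0 < j → 0 < l → arc d x i ⊆ A → arc d y j ⊆ A →
      arc d z l ⊆ A → arc d (x + y + z) (i + j - 1 + l - 1) ⊆ 3 • A := by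
    intro x y z i j l hi hj hl hx hy hz
    have h1 : 3 • A = A + A + A := by
      rw [nsmul_succ_eq, nsmul_succ_eq, one_nsmul_eq]
    rw [h1]
    refine (arc_subset_arc_add (by omega) hl).trans (Finset.add_subset_add ?_ hz)
    exact (arc_subset_arc_add hi hj).trans (Finset.add_subset_add hx hy)
  have hU := Finset.card_le_card (Finset.union_subset (Finset.union_subset (Finset.union_subset
    (h3A hp hp hp hpsub hpsub hpsub) (h3A hp hp hq hpsub hpsub hqsub))
    (h3A hp hq hq hpsub hqsub hqsub)) (h3A hq hq hq hqsub hqsub hqsub))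
  have e1 : ∀ x : G, e + e + x - (e + f + x) = e - f := fun x => by abel
  have e2 : e + e + e - (e + e + f) = e - f := by abel
  have e3 : e + e + e - (e + f + f) = 2 • (e - f) := by rw [two_nsmul]; abel
  have e4 : e + e + e - (f + f + f) = 3 • (e - f) := by abel
  have e5 : e + e + f - (f + f + f) = 2 • (e - f) := by rw [two_nsmul]; abel
  have e6 : e + f + f - (f + f + f) = e - f := by abel
  rw [Finset.card_union_of_disjoint, Finset.card_union_of_disjoint,
    Finset.card_union_of_disjoint] at hU
  rotate_left
  · exact hdisj _ _ (by rwa [e2])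
  · rw [Finset.disjoint_union_left]
    exact ⟨hdisj _ _ (by rwa [e3]), hdisj _ _ (by rwa [e1])⟩
  · rw [Finset.disjoint_union_left, Finset.disjoint_union_left]
    exact ⟨⟨hdisj _ _ (by rwa [e4]), hdisj _ _ (by rwa [e5])⟩, hdisj _ _ (by rwa [e6])⟩
  have u1 := min_le_card_arc d (e + e + e) (p + p - 1 + p - 1)
  have u2 := min_le_card_arc d (e + e + f) (p + p - 1 + q - 1)
  have u3 := min_le_card_arc d (e + f + f) (p + q - 1 + q - 1)
  have u4 := min_le_card_arc d (f + f + f) (q + q - 1 + q - 1)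
  have h5 := hA.three_nsmul
  have h6 := hA.three_le
  omega

omit [Fintype G] in
theorem addOrderOf_le_card_inter_add_one [Finite G] {d e f : G} (hd : d ∈ boundary A e)
    (huniq : ∀ x ∈ boundary A e, x - d ∈ AddSubgroup.zmultiples e → x = d)
    (hf : f ∈ AddSubgroup.zmultiples e) (hf0 : f ≠ 0) (hfe : f ≠ e)
    (hA : ∀ a ∈ A, a + f ∈ A ∨ a + f - e ∈ A) :
    addOrderOf e ≤ (A ∩ coset (AddSubgroup.zmultiples e) d).card + 1 := by
  obtain ⟨l, hl0, hl, harc⟩ := eq_arc_of_boundary hd huniq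
  rw [harc, card_arc hl.le]
  by_contra! hlt
  rw [mem_zmultiples_iff_mem_range_addOrderOf] at hf
  obtain ⟨j, hj, rfl⟩ := Finset.mem_image.1 hf
  rw [Finset.mem_range] at hj
  have hj0 : j ≠ 0 := by
    rintro rfl
    exact hf0 (zero_nsmul e)
  have hj1 : j ≠ 1 := by
    rintro rfl
    exact hfe (one_nsmul e)
  obtain ⟨t, ht⟩ : ∃ t, t + j = addOrderOf e := ⟨addOrderOf e - j, by omega⟩
  have hte : j • e = -(t • e) := by
    rw [eq_neg_iff_add_eq_zero, add_comm, ← add_nsmul, ht, addOrderOf_nsmul_eq_zero]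
  have hmem : ∀ i, l ≤ i → i < addOrderOf e → d - i • e ∉ A := by
    intro i hi hi' h
    refine sub_nsmul_mem_arc hi hi' (e := d) ?_
    rw [← harc, Finset.mem_inter, mem_coset, sub_sub_cancel_left]
    exact ⟨h, neg_mem (AddSubgroup.nsmul_mem_zmultiples e i)⟩
  have hstep : ∀ i < l, l ≤ i + t → i + t + 1 < addOrderOf e → False := by
    intro i hi h1 h2
    have h3 : d - i • e ∈ A := by
      have h4 : d - i • e ∈ arc e d l := mem_arc.2 ⟨i, hi, rfl⟩
      rw [← harc] at h4
      exact (Finset.mem_inter.1 h4).1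
    have h4 : d - i • e + j • e = d - (i + t) • e := by
      rw [hte, add_nsmul]
      abel
    rcases hA _ h3 with h5 | h5
    · rw [h4] at h5
      exact hmem _ h1 (by omega) h5
    · rw [h4, sub_sub, ← succ_nsmul] at h5
      exact hmem _ (by omega) h2 h5
  by_cases h : l ≤ t
  · exact hstep 0 hl0 (by omega) (by omega)
  · exact hstep (l - t) (by omega) (by omega) (by omega)

theorem IsExtremal.mem_zmultiples (hA : IsExtremal A n) {d e : G} (hd : d ≠ 0)
    (h3 : (boundary A d).card ≤ 3) (he : ∀ a ∈ A, a + e ∈ A ∨ a + e - d ∈ A) :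
    e ∈ AddSubgroup.zmultiples d := by
  by_contra hed
  set H := AddSubgroup.zmultiples d with hH
  have hC3 : (hull A H).card ≤ 3 * Nat.card H := by
    have h1 : hull A H ⊆ (boundary A d).biUnion fun e => coset H e := by
      intro x hx
      obtain ⟨a, ha, hxa⟩ := mem_hull.1 hx
      obtain ⟨e, he, hae⟩ := hA.exists_boundary hd h3 ha
      refine Finset.mem_biUnion.2 ⟨e, he, mem_coset.2 ?_⟩
      have := H.add_mem hxa hae
      simpa using this
    have h2 := (Finset.card_le_card h1).trans Finset.card_biUnion_le
    simp only [card_coset, Finset.sum_const, smul_eq_mul] at h2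
    exact h2.trans (Nat.mul_le_mul_right _ h3)
  have hmemS : ∀ g : G, (∀ x ∈ hull A H, x + g ∈ hull A H) →
      g ∈ AddAction.stabilizer G (hull A H) := by
    intro g hg
    rw [AddAction.mem_stabilizer_iff]
    refine Finset.eq_of_subset_of_card_le ?_ (by rw [Finset.card_vadd_finset])
    intro x hx
    have := hg _ (mem_vadd_iff_sub.1 hx)
    simpa using this
  set S := AddAction.stabilizer G (hull A H) with hS
  have hHS : H ≤ S := by
    refine fun g hg => hmemS g fun x hx => ?_
    obtain ⟨a, ha, hxa⟩ := mem_hull.1 hx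
    refine mem_hull.2 ⟨a, ha, ?_⟩
    have := H.add_mem hxa hg
    convert this using 1
    abel
  have heS : e ∈ S := by
    refine hmemS e fun x hx => ?_
    obtain ⟨a, ha, hxa⟩ := mem_hull.1 hx
    rcases he a ha with h | h
    · refine mem_hull.2 ⟨_, h, ?_⟩
      simpa using hxa
    · refine mem_hull.2 ⟨_, h, ?_⟩
      have := H.add_mem hxa (AddSubgroup.mem_zmultiples d)
      convert this using 1
      abel
  have hcoset : ∀ x ∈ hull A H, coset S x ⊆ hull A H := by
    intro x hx z hz
    rw [mem_coset, hS, AddAction.mem_stabilizer_iff] at hz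
    rw [← hz, mem_vadd_iff_sub]
    simpa using hx
  obtain ⟨a, ha⟩ : A.Nonempty := Finset.card_pos.1 (by have := hA.three_le; omega)
  have hSH : 2 * Nat.card H ≤ Nat.card S := by
    have h1 : coset H e ∪ coset H 0 ⊆ coset S 0 := by
      intro x hx
      rw [Finset.mem_union, mem_coset, mem_coset, sub_zero] at hx
      rw [mem_coset, sub_zero]
      rcases hx with hx | hx
      · have := S.add_mem (hHS hx) heS
        simpa using this
      · exact hHS hx
    have h2 := Finset.card_le_card h1
    rw [Finset.card_union_of_disjoint (disjoint_coset (by simpa using hed)), card_coset,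
      card_coset, card_coset] at h2
    omega
  have hlt := hA.three_mul_addOrderOf_lt d
  rw [← hH] at hlt
  have htop : S ≠ ⊤ := by
    intro h
    have h1 := eq_univ_of_stabilizer_eq_top ⟨a, subset_hull A H ha⟩ h
    rw [h1, Finset.card_univ] at hC3
    omega
  obtain ⟨b, hb, hba⟩ := exists_sub_notMem hA.gen htop a
  have h1 := Finset.card_le_card (Finset.union_subset (hcoset b (subset_hull A H hb))
    (hcoset a (subset_hull A H ha)))
  rw [Finset.card_union_of_disjoint (disjoint_coset hba), card_coset, card_coset] at h1
  have h2 : 0 < Nat.card H := Nat.card_pos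
  omega

theorem IsExtremal.addOrderOf_le_three (hA : IsExtremal A n) {d e : G} (hd : d ≠ 0)
    (h3 : (boundary A d).card ≤ 3) (he0 : e ≠ 0) (hed : e ≠ d)
    (he : ∀ a ∈ A, a + e ∈ A ∨ a + e - d ∈ A) : addOrderOf d ≤ 3 := by
  have hmem := hA.mem_zmultiples hd h3 he
  have hbig : ∀ {x : G}, x ∈ boundary A d →
      (∀ y ∈ boundary A d, y - x ∈ AddSubgroup.zmultiples d → y = x) →
      addOrderOf d ≤ (A ∩ coset (AddSubgroup.zmultiples d) x).card + 1 :=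
    fun hx hu => addOrderOf_le_card_inter_add_one hx hu hmem he0 hed he
  have hhole := hA.hole (AddSubgroup.zmultiples d)
    (by rwa [Ne, AddSubgroup.zmultiples_eq_bot]) (hA.zmultiples_ne_top d)
  have hcard := Nat.card_zmultiples d
  obtain ⟨x, hx, y, hy, hxy⟩ := hA.exists_boundary_pair hd h3
  set H := AddSubgroup.zmultiples d with hH
  have hyx : y - x ∉ H := fun h => hxy (by simpa using neg_mem h)
  have hne : ∀ {x y : G}, x - y ∉ H → x ≠ y := by
    rintro x _ h rfl
    exact h (by simp)
  by_cases hcase : ∀ z ∈ boundary A d, z - x ∈ H ∨ z - y ∈ H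
  · exfalso
    have hcov : ∀ a ∈ A, a - x ∈ H ∨ a - y ∈ H := by
      intro a ha
      obtain ⟨z, hz, haz⟩ := hA.exists_boundary hd h3 ha
      rcases hcase z hz with h | h
      · left
        have := H.add_mem haz h
        simpa using this
      · right
        have := H.add_mem haz h
        simpa using this
    have hk := hA.card_lt hcov
    have hsmall : ∀ {u v : G}, v ∈ A → u - v ∉ H → (A ∩ coset H u).card + 1 ≤ A.card := by
      intro u v hv huv
      refine Finset.card_lt_card (Finset.ssubset_iff_subset_ne.2 ⟨Finset.inter_subset_left, ?_⟩)
      intro h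
      rw [← h, Finset.mem_inter, mem_coset] at hv
      exact huv (by simpa using neg_mem hv.2)
    by_cases hux : ∀ z ∈ boundary A d, z - x ∈ H → z = x
    · have h1 := hbig hx hux
      have h2 := hsmall (mem_boundary.1 hy).1 hxy
      omega
    by_cases huy : ∀ z ∈ boundary A d, z - y ∈ H → z = y
    · have h1 := hbig hy huy
      have h2 := hsmall (mem_boundary.1 hx).1 hyx
      omega
    push Not at hux huy
    obtain ⟨x', hx', hxx, hxn⟩ := hux
    obtain ⟨y', hy', hyy, hyn⟩ := huy
    have h1 : x' - y ∉ H := fun h => hxy (by simpa using H.sub_mem h hxx)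
    have h2 : x - y' ∉ H := fun h => hxy (by simpa using H.add_mem h hyy)
    have h4 : x' - y' ∉ H := fun h => h1 (by simpa using H.add_mem h hyy)
    have h5 : ({x', x, y', y} : Finset G) ⊆ boundary A d := by
      intro z hz
      simp only [Finset.mem_insert, Finset.mem_singleton] at hz
      rcases hz with rfl | rfl | rfl | rfl <;> assumption
    have h6 := Finset.card_le_card h5
    rw [Finset.card_insert_of_notMem (by simp [hxn, hne h4, hne h1]),
      Finset.card_insert_of_notMem (by simp [hne h2, hne hxy]), Finset.card_pair hyn] at h6
    omega
  · push Not at hcase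
    obtain ⟨z, hz, hzx, hzy⟩ := hcase
    have hsub : ({z, x, y} : Finset G) ⊆ boundary A d := by
      intro w hw
      simp only [Finset.mem_insert, Finset.mem_singleton] at hw
      rcases hw with rfl | rfl | rfl <;> assumption
    have hc3 : ({z, x, y} : Finset G).card = 3 := by
      rw [Finset.card_insert_of_notMem (by simp [hne hzx, hne hzy]), Finset.card_pair (hne hxy)]
    have hE := Finset.eq_of_subset_of_card_le hsub (by rwa [hc3])
    have hxz : x - z ∉ H := fun h => hzx (by simpa using neg_mem h)
    have hyz : y - z ∉ H := fun h => hzy (by simpa using neg_mem h)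
    have hbig' : ∀ w ∈ boundary A d, addOrderOf d ≤ (A ∩ coset H w).card + 1 := by
      intro w hw
      refine hbig hw fun v hv hvw => ?_
      rw [← hE] at hv hw
      simp only [Finset.mem_insert, Finset.mem_singleton] at hv hw
      rcases hv with rfl | rfl | rfl <;> rcases hw with rfl | rfl | rfl <;>
        first | rfl | contradiction
    have h1 := hbig' x hx
    have h2 := hbig' y hy
    have h4 := hbig' z hz
    have h5 := Finset.card_le_card (Finset.union_subset (Finset.union_subset
      (Finset.inter_subset_left (s₁ := A) (s₂ := coset H x))
      (Finset.inter_subset_left (s₁ := A) (s₂ := coset H y)))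
      (Finset.inter_subset_left (s₁ := A) (s₂ := coset H z)))
    have hdisj : ∀ {u v : G}, u - v ∉ H → Disjoint (A ∩ coset H u) (A ∩ coset H v) := fun h =>
      (disjoint_coset h).mono Finset.inter_subset_right Finset.inter_subset_right
    rw [Finset.card_union_of_disjoint, Finset.card_union_of_disjoint (hdisj hxy)] at h5
    rotate_left
    · rw [Finset.disjoint_union_left]
      exact ⟨hdisj hxz, hdisj hyz⟩
    have h6 : hull A H ⊆ (boundary A d).biUnion fun e => coset H e := by
      intro w hw
      obtain ⟨a, ha, hwa⟩ := mem_hull.1 hw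
      obtain ⟨e, he, hae⟩ := hA.exists_boundary hd h3 ha
      refine Finset.mem_biUnion.2 ⟨e, he, mem_coset.2 ?_⟩
      have := H.add_mem hwa hae
      simpa using this
    have h7 := (Finset.card_le_card h6).trans Finset.card_biUnion_le
    simp only [card_coset, Finset.sum_const, smul_eq_mul] at h7
    have h8 := Nat.mul_le_mul_right (Nat.card H) h3
    omega

theorem IsExtremal.not_isSidon (hA : IsExtremal A n) {M : Finset G} (hM : IsAtom ⊤ A M)
    (hc : (M + A).card ≤ A.card + M.card) : ¬ IsSidon M := by
  intro hS
  have hAne : A.Nonempty := Finset.card_pos.1 (by have := hA.three_le; omega)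
  have h3 := hM.card_le_two_add (ε := 1) le_rfl hA.hole hAne hS (by omega)
  have h2 := hM.two_le
  rcases (show M.card = 2 ∨ M.card = 3 by omega) with hMc | hMc
  · obtain ⟨x, y, hxy, rfl⟩ := Finset.card_eq_two.1 hMc
    have h4 := card_pair_add A x (y - x)
    rw [add_sub_cancel] at h4
    have h5 := hA.two_lt_card_boundary (sub_ne_zero.2 hxy.symm)
    omega
  · obtain ⟨x, y, z, hxy, hxz, hyz, rfl⟩ := Finset.card_eq_three.1 hMc
    have h4 := hM.erase_add (by omega) (y := z) (by simp)
    have h5 : ({x, y, z} : Finset G).erase z = {x, y} := by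
      ext w
      simp only [Finset.mem_erase, Finset.mem_insert, Finset.mem_singleton]
      constructor
      · rintro ⟨h, h' | h' | h'⟩
        · exact Or.inl h'
        · exact Or.inr h'
        · exact absurd h' h
      · rintro (rfl | rfl)
        · exact ⟨hxz, Or.inl rfl⟩
        · exact ⟨hyz, Or.inr (Or.inl rfl)⟩
    rw [h5] at h4
    have h6 := card_pair_add A x (y - x)
    rw [add_sub_cancel, h4] at h6
    have hd : y - x ≠ 0 := sub_ne_zero.2 hxy.symm
    have h7 : (boundary A (y - x)).card ≤ 3 := by omega
    have h8 : ∀ a ∈ A, a + (z - x) ∈ A ∨ a + (z - x) - (y - x) ∈ A := by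
      intro a ha
      have h9 : z + a ∈ ({x, y} : Finset G) + A := by
        rw [h4]
        exact Finset.add_mem_add (by simp) ha
      obtain ⟨w, hw, b, hb, hwb⟩ := Finset.mem_add.1 h9
      rw [Finset.mem_insert, Finset.mem_singleton] at hw
      rcases hw with rfl | rfl
      · left
        have h10 : a + (z - w) = b := by
          rw [← add_sub_assoc, add_comm a, ← hwb, add_sub_cancel_left]
        rwa [h10]
      · right
        have h10 : a + (z - x) - (w - x) = b := by
          rw [sub_sub_eq_add_sub, add_assoc, sub_add_cancel, add_comm a, ← hwb,
            add_sub_cancel_left]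
        rwa [h10]
    have h9 := hA.mem_zmultiples hd h7 h8
    have h10 := hA.addOrderOf_le_three hd h7 (sub_ne_zero.2 hxz.symm)
      (fun h => hyz (sub_left_injective h).symm) h8
    have h11 : ({x, y, z} : Finset G) ⊆ coset (AddSubgroup.zmultiples (y - x)) x := by
      intro w hw
      simp only [Finset.mem_insert, Finset.mem_singleton] at hw
      rw [mem_coset]
      rcases hw with rfl | rfl | rfl
      · simp
      · exact AddSubgroup.mem_zmultiples _
      · exact h9
    have h12 := Finset.eq_of_subset_of_card_le h11 (by rwa [card_coset, hMc, Nat.card_zmultiples])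
    have h13 := hS (y - x) hd
    rw [Finset.inter_eq_left.2, hMc] at h13
    · omega
    · rw [h12]
      intro w hw
      rw [mem_vadd_iff_sub, mem_coset]
      have := sub_mem (mem_coset.1 hw) (AddSubgroup.mem_zmultiples (y - x))
      convert this using 1
      abel

theorem IsExtremal.card_add_card_lt_card_hull (hA : IsExtremal A n) {H : AddSubgroup G}
    (hap : ∃ y ∈ n • A, ∃ h ∈ H, y + h ∉ n • A) (hbot : H ≠ ⊥) (htop : H ≠ ⊤) :
    A.card + Nat.card H < (hull A H).card := by
  by_contra! hcon
  have hpair : ∃ b ∈ A, ∃ c ∈ A, b - c ∉ H ∧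
      (A ∩ coset H b).card + (A ∩ coset H c).card ≤ Nat.card H := by
    by_contra! h
    obtain ⟨y, hy, g, hg, hyg⟩ := hap
    exact hyg (nsmul_periodic_of_card_lt hA.gen hA.exponent_lt htop h hy hg)
  obtain ⟨b, hb, c, hc, hbc, hle⟩ := hpair
  have hd : Disjoint (coset H b \ A) (coset H c \ A) :=
    (disjoint_coset hbc).mono Finset.sdiff_subset Finset.sdiff_subset
  have h1 : (coset H b \ A) ∪ (coset H c \ A) ⊆ hull A H \ A :=
    Finset.union_subset (Finset.sdiff_subset_sdiff (coset_subset_hull hb) subset_rfl)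
      (Finset.sdiff_subset_sdiff (coset_subset_hull hc) subset_rfl)
  have h2 : (coset H b \ A) ∪ (coset H c \ A) = hull A H \ A := by
    refine Finset.eq_of_subset_of_card_le h1 ?_
    rw [Finset.card_union_of_disjoint hd, Finset.card_sdiff_of_subset (subset_hull A H)]
    have h3 := Finset.card_sdiff_add_card_inter (coset H b) A
    have h4 := Finset.card_sdiff_add_card_inter (coset H c) A
    rw [card_coset, Finset.inter_comm] at h3 h4
    omega
  have hrest : ∀ z ∈ hull A H, z - b ∉ H → z - c ∉ H → z ∈ fullPart A H := by
    have h3 : ∀ z ∈ hull A H, z - b ∉ H → z - c ∉ H → z ∈ A := by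
      intro z hz hzb hzc
      by_contra hzA
      have h4 : z ∈ hull A H \ A := Finset.mem_sdiff.2 ⟨hz, hzA⟩
      rw [← h2, Finset.mem_union, Finset.mem_sdiff, Finset.mem_sdiff, mem_coset, mem_coset] at h4
      tauto
    intro z hz hzb hzc
    refine mem_fullPart.2 ⟨h3 z hz hzb hzc, fun w hw => ?_⟩
    rw [mem_coset] at hw
    obtain ⟨a, ha, hza⟩ := mem_hull.1 hz
    refine h3 w (mem_hull.2 ⟨a, ha, ?_⟩) (fun h => hzb ?_) fun h => hzc ?_
    · simpa using H.add_mem hw hza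
    · simpa using H.sub_mem h hw
    · simpa using H.sub_mem h hw
  have h3 := hA.hole H hbot htop
  have h4 : hull A H ⊆ fullPart A H ∪ (coset H b ∪ coset H c) := by
    intro z hz
    rw [Finset.mem_union, Finset.mem_union, mem_coset, mem_coset]
    have := hrest z hz
    tauto
  have h5 := (Finset.card_le_card h4).trans (Finset.card_union_le _ _)
  have h6 := Finset.card_union_le (coset H b) (coset H c)
  rw [card_coset, card_coset] at h6
  have h7 : 0 < Nat.card H := Nat.card_pos
  by_cases hF : (fullPart A H).Nonempty
  · have h8 := hA.full H hbot hF
    rw [hA.card_eq] at h8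
    have h9 := hA.four_le
    obtain ⟨r, rfl⟩ : ∃ r, n = r + 1 := ⟨n - 1, by omega⟩
    simp only [Nat.add_sub_cancel] at h8
    have h12 := Nat.mul_le_mul_left r h3
    have h13 := Nat.mul_le_mul_right (Nat.card H) (show 3 ≤ r by omega)
    rw [Nat.add_mul] at h8
    rw [Nat.mul_add] at h12
    omega
  · rw [Finset.not_nonempty_iff_eq_empty] at hF
    have h8 : ∀ a ∈ A, a - b ∈ H ∨ a - c ∈ H := by
      intro a ha
      by_contra! h
      have := hrest a (subset_hull A H ha) h.1 h.2
      simp [hF] at this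
    have h9 := hA.card_lt h8
    rw [hF, Finset.card_empty] at h5
    have h10 := Finset.card_le_card (Finset.union_subset (coset_subset_hull (H := H) hb)
      (coset_subset_hull hc))
    rw [Finset.card_union_of_disjoint (disjoint_coset hbc), card_coset, card_coset] at h10
    omega

theorem IsExtremal.two_mul_card_lt (hA : IsExtremal A n)
    (hap : ∀ H : AddSubgroup G, H ≠ ⊥ → ∃ y ∈ n • A, ∃ h ∈ H, y + h ∉ n • A) :
    2 * A.card < (2 • A).card := by
  by_contra! h2
  have h3 := hA.three_le
  have hAne : A.Nonempty := Finset.card_pos.1 (by omega)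
  rw [nsmul_succ_eq, one_nsmul_eq] at h2
  have h4 : (A + A).card + 2 ≤ Nat.card (⊤ : AddSubgroup G) := by
    rw [card_top_eq, hA.card_eq]
    have := Nat.mul_le_mul_right A.card hA.four_le
    omega
  obtain ⟨M, hM⟩ := exists_isAtom (L := ⊤) hAne (X := A) (by simp) (by omega) h4
  have hle := hM.le A (by simp) (by omega) h4
  have hM2 := hM.two_le
  rcases hM.isSidon_or_coset (by simp) hAne with hS | ⟨H, b, rfl⟩
  · exact hA.not_isSidon hM (by omega) hS
  · have h5 := hM.add_two_le
    rw [card_coset_add, card_top_eq] at h5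
    rw [card_coset_add, card_coset] at hle
    rw [card_coset] at hM2
    have hbot : H ≠ ⊥ := by
      rintro rfl
      rw [AddSubgroup.card_bot] at hM2
      omega
    have htop : H ≠ ⊤ := by
      rintro rfl
      have h6 := Finset.card_le_card (coset_subset_hull (H := ⊤) hAne.choose_spec)
      rw [card_coset, card_top_eq] at h6
      omega
    have h6 := hA.card_add_card_lt_card_hull (hap H hbot) hbot htop
    omega

end Extremal

section Main

theorem card_hull_eq [Finite G] [DecidableEq G] (H : AddSubgroup G) [DecidableEq (G ⧸ H)]
    (X : Finset G) :
    (hull X H).card = (X.image (QuotientAddGroup.mk' H)).card * Nat.card H := by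
  have hmap : ∀ x ∈ hull X H, QuotientAddGroup.mk' H x ∈ X.image (QuotientAddGroup.mk' H) := by
    intro x hx
    obtain ⟨a, ha, hxa⟩ := mem_hull.1 hx
    refine Finset.mem_image.2 ⟨a, ha, ?_⟩
    rw [QuotientAddGroup.mk'_apply, QuotientAddGroup.mk'_apply, QuotientAddGroup.eq,
      neg_add_eq_sub]
    exact hxa
  rw [Finset.card_eq_sum_card_fiberwise hmap, Finset.sum_const_nat]
  intro q hq
  obtain ⟨a, ha, rfl⟩ := Finset.mem_image.1 hq
  rw [← card_coset H a]
  congr 1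
  ext x
  rw [Finset.mem_filter, QuotientAddGroup.mk'_apply, QuotientAddGroup.mk'_apply,
    eq_comm (a := (x : G ⧸ H)), QuotientAddGroup.eq, neg_add_eq_sub, mem_coset, mem_hull]
  exact ⟨fun h => h.2, fun h => ⟨⟨a, ha, h⟩, h⟩⟩

theorem closure_image_sub_eq_top [DecidableEq G] {A : Finset G}
    (hgen : AddSubgroup.closure ((A : Set G) - (A : Set G)) = ⊤) (H : AddSubgroup G)
    [DecidableEq (G ⧸ H)] :
    AddSubgroup.closure ((A.image (QuotientAddGroup.mk' H) : Set (G ⧸ H)) -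
      (A.image (QuotientAddGroup.mk' H) : Set (G ⧸ H))) = ⊤ := by
  rw [Finset.coe_image, ← Set.image_sub, ← AddMonoidHom.map_closure, hgen,
    ← AddMonoidHom.range_eq_map, AddMonoidHom.range_eq_top]
  exact QuotientAddGroup.mk'_surjective H

theorem exponent_quotient_le [Finite G] (H : AddSubgroup G) :
    AddMonoid.exponent (G ⧸ H) ≤ AddMonoid.exponent G := by
  refine Nat.le_of_dvd (AddMonoid.exponent_pos.2 AddMonoid.ExponentExists.of_finite) ?_
  rw [AddMonoid.exponent_dvd_iff_forall_nsmul_eq_zero]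
  intro q
  obtain ⟨g, rfl⟩ := QuotientAddGroup.mk'_surjective H q
  rw [← map_nsmul, AddMonoid.exponent_nsmul_eq_zero, map_zero]

theorem min_card_mul_hull_le [Finite G] [DecidableEq G] {A : Finset G} {n : ℕ} (H : AddSubgroup G)
    [DecidableEq (G ⧸ H)]
    (h : min (Nat.card (G ⧸ H)) (n * (A.image (QuotientAddGroup.mk' H)).card) ≤
      (n • A.image (QuotientAddGroup.mk' H)).card) :
    min (Nat.card G) (n * (hull A H).card) ≤ (hull (n • A) H).card := by
  rw [card_hull_eq, card_hull_eq, Finset.image_nsmul, ← mul_assoc,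
    AddSubgroup.card_eq_card_quotient_mul_card_addSubgroup H, Nat.mul_min_mul_right]
  exact Nat.mul_le_mul_right _ h

theorem min_card_le_of_aperiodic [DecidableEq G] [Fintype G] {A : Finset G} {n : ℕ}
    (hA : A.Nonempty) (hgen : AddSubgroup.closure ((A : Set G) - (A : Set G)) = ⊤)
    (hn : AddMonoid.exponent G + 1 ≤ n) (hn3 : 3 ≤ n)
    (hap : ∀ H : AddSubgroup G, H ≠ ⊥ → ∃ y ∈ n • A, ∃ h ∈ H, y + h ∉ n • A)
    (ih : ∀ H : AddSubgroup G, H ≠ ⊥ → AddMonoid.exponent G + 1 ≤ n - 1 → 3 ≤ n - 1 →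
      min (Fintype.card G) ((n - 1) * (hull A H).card) ≤ (hull ((n - 1) • A) H).card) :
    min (Fintype.card G) (n * A.card) ≤ (n • A).card := by
  by_contra! hcon
  have hexp : 0 < AddMonoid.exponent G :=
    AddMonoid.exponent_pos.2 AddMonoid.ExponentExists.of_finite
  have hG : n ≤ Fintype.card G := by
    have := min_card_le_card_nsmul hA hgen n
    omega
  have hole : ∀ L : AddSubgroup G, L ≠ ⊥ → L ≠ ⊤ → A.card + Nat.card L ≤ (hull A L).card :=
    fun L hb ht => card_add_card_le_card_hull hgen hn hap hb ht
  have hk : 3 ≤ A.card := by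
    by_contra! hk
    obtain ⟨b, c, hbc⟩ : ∃ b c, ∀ a ∈ A, a = b ∨ a = c := by
      have h1 := hA.card_pos
      rcases (show A.card = 1 ∨ A.card = 2 by omega) with h | h
      · obtain ⟨b, rfl⟩ := Finset.card_eq_one.1 h
        exact ⟨b, b, by simp⟩
      · obtain ⟨b, c, -, rfl⟩ := Finset.card_eq_two.1 h
        exact ⟨b, c, by simp⟩
    have h1 := card_le_mul_of_subset_union hgen (H := ⊥) (b := b) (c := c)
      (fun a ha => (hbc a ha).imp (fun h => by simp [h]) fun h => by simp [h]) hexp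
      (by rw [AddMonoid.exponent_nsmul_eq_zero]; exact zero_mem _)
    rw [AddSubgroup.card_bot, Nat.card_eq_fintype_card] at h1
    omega
  obtain ⟨x, hx⟩ : ∃ x, x ∉ n • A := by
    by_contra! h
    rw [Finset.eq_univ_iff_forall.2 h, Finset.card_univ] at hcon
    omega
  have hn1 : n - 1 + 1 = n := by omega
  have hgrow := fun {j : ℕ} => card_nsmul_add_le (j := j) (by omega : 2 ≤ A.card) hn hG hole
  have hpre : ((n - 1) • A).card + A.card ≤ Fintype.card G := by
    refine card_add_card_le_of_notMem (x := x) ?_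
    rwa [← nsmul_succ_eq, hn1]
  have hfrom : ∀ j, 0 < j → j ≤ n - 1 →
      (j • A).card + (n - 1 - j) * A.card ≤ ((n - 1) • A).card := by
    intro j hj hjn
    have h1 : j + (n - 1 - j) = n - 1 := by omega
    have h2 := hgrow hj (n - 1 - j) (by rw [h1]; omega)
    rwa [h1] at h2
  have hbig : Fintype.card G < (n • A).card + 2 := by
    by_contra! h
    have h1 : 1 + (n - 1) = n := by omega
    have h2 := hgrow one_pos (n - 1) (by rwa [h1])
    rw [one_nsmul_eq, h1] at h2
    have h3 : n * A.card = A.card + (n - 1) * A.card := by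
      conv_lhs => rw [← h1, add_mul, one_mul]
    omega
  have hsplit : ∀ j, j + 1 ≤ n → n * A.card = j * A.card + (n - 1 - j) * A.card + A.card := by
    intro j hj
    obtain ⟨r, rfl⟩ : ∃ r, n = j + 1 + r := ⟨n - (j + 1), by omega⟩
    have : j + 1 + r - 1 - j = r := by omega
    rw [this]
    ring
  have hcard : Fintype.card G = n * A.card := by
    have h1 := hfrom 1 one_pos (by omega)
    have h2 := hsplit 1 (by omega)
    rw [one_nsmul_eq] at h1
    omega
  have hsmall : ∀ j, 0 < j → j ≤ n - 1 → (j • A).card ≤ j * A.card := by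
    intro j hj hjn
    have h1 := hfrom j hj hjn
    have h2 := hsplit j (by omega)
    omega
  have hprime := Nat.minFac_prime (show n ≠ 1 by omega)
  have : Fact n.minFac.Prime := ⟨hprime⟩
  obtain ⟨y, hy⟩ := exists_prime_addOrderOf_dvd_card n.minFac
    (show n.minFac ∣ Fintype.card G from hcard ▸ Dvd.dvd.mul_right n.minFac_dvd _)
  have hdvd : n.minFac ∣ AddMonoid.exponent G := hy ▸ AddMonoid.addOrder_dvd_exponent y
  have hn2 : AddMonoid.exponent G + 2 ≤ n := by
    by_contra! h
    have h1 : AddMonoid.exponent G + 1 = n := by omega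
    have h2 : n.minFac ∣ 1 := (Nat.dvd_add_right hdvd).1 (h1 ▸ n.minFac_dvd)
    exact hprime.one_lt.ne' (Nat.dvd_one.1 h2)
  have hn4 : 4 ≤ n := by
    have := Nat.le_of_dvd hexp hdvd
    have := hprime.two_le
    omega
  have hext : IsExtremal A n :=
    { gen := hgen
      exponent_lt := hn
      four_le := hn4
      three_le := hk
      card_eq := hcard
      hole := hole
      full := fun L hL hF => mul_card_hull_add_le (ih L hL (by omega) (by omega)) hF
        (x := x) (by rwa [hn1])
      three_nsmul := hsmall 3 (by omega) (by omega) }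
  have h1 := hext.two_mul_card_lt hap
  have h2 := hsmall 2 (by omega) (by omega)
  omega

theorem min_card_mul_le_card_nsmul (N : ℕ) : ∀ {G : Type*} [AddCommGroup G] [Finite G]
    [DecidableEq G] {A : Finset G} {n : ℕ}, Nat.card G ≤ N → A.Nonempty →
    AddSubgroup.closure ((A : Set G) - (A : Set G)) = ⊤ → AddMonoid.exponent G + 1 ≤ n → 3 ≤ n →
    min (Nat.card G) (n * A.card) ≤ (n • A).card := by
  classical
  induction N with
  | zero =>
    intro G _ _ _ A n hN
    have := Nat.card_pos (α := G)
    omega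
  | succ N ih =>
    intro G _ _ _ A n hN hA hgen hn hn3
    have hquot : ∀ H : AddSubgroup G, H ≠ ⊥ → ∀ r, AddMonoid.exponent G + 1 ≤ r → 3 ≤ r →
        min (Nat.card G) (r * (hull A H).card) ≤ (hull (r • A) H).card := by
      intro H hH r hr hr3
      refine min_card_mul_hull_le H (ih ?_ (hA.image _) (closure_image_sub_eq_top hgen H) ?_ hr3)
      · have h1 := AddSubgroup.card_eq_card_quotient_mul_card_addSubgroup H
        have h2 := two_le_natCard hH
        have h3 := Nat.card_pos (α := G ⧸ H)
        nlinarith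
      · have := exponent_quotient_le H
        omega
    by_cases hap : ∀ H : AddSubgroup G, H ≠ ⊥ → ∃ y ∈ n • A, ∃ h ∈ H, y + h ∉ n • A
    · have := Fintype.ofFinite G
      have h1 := min_card_le_of_aperiodic hA hgen hn hn3 hap fun H hH h1 h2 => by
        rw [← Nat.card_eq_fintype_card]
        exact hquot H hH _ h1 h2
      rwa [← Nat.card_eq_fintype_card] at h1
    · push Not at hap
      obtain ⟨H, hH, hper⟩ := hap
      have h1 : hull (n • A) H ⊆ n • A := by
        intro x hx
        obtain ⟨y, hy, hxy⟩ := mem_hull.1 hx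
        simpa using hper y hy _ hxy
      have h2 := hquot H hH n hn hn3
      have h3 := Finset.card_le_card h1
      have h4 := Nat.mul_le_mul_left n (Finset.card_le_card (subset_hull A H))
      omega

end Main

end IteratedSumset

theorem stmt10 {G : Type*} [AddCommGroup G] [Fintype G] [DecidableEq G]
    (A : Finset G) (hA : A.Nonempty)
    (hgen : AddSubgroup.closure ((A : Set G) - (A : Set G)) = ⊤)
    (n : ℕ) (hn : AddMonoid.exponent G + 1 ≤ n) (hn3 : 3 ≤ n) :
    min (Fintype.card G) (n * A.card) ≤ (n • A).card := by
  have h := IteratedSumset.min_card_mul_le_card_nsmul (Nat.card G) le_rfl hA hgen hn hn3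
  rwa [Nat.card_eq_fintype_card] at h
end

section
/- Let G be an abelian group, let A_1, ..., A_n be finite nonempty subsets of G, and let H = H(A_1 + ... + A_n) be the stabilizer of the sumset. Then |A_1 + ... + A_n| ≥ Σ_{i=1}^n |A_i + H| − (n−1)|H| (Kneser's theorem for multiple summands). -/
open Pointwise

/-- The finset `C` is periodic under a finite subgroup `K` with `m ≤ |C| + |K|`. -/
def HasPeriodBound {G : Type*} [AddCommGroup G] (C : Finset G) (m : ℕ) : Prop :=
  ∃ (K : AddSubgroup G) (F : Finset G), (∀ g, g ∈ F ↔ g ∈ K) ∧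
    (∀ k ∈ K, ∀ c ∈ C, k + c ∈ C) ∧ m ≤ C.card + F.card

section

variable {G : Type*} [AddCommGroup G] [DecidableEq G]

theorem card_mul_card_le_card_add_mul_card_inter {K₁ K₂ : AddSubgroup G} {F₁ F₂ S T : Finset G}
    (hF₁ : ∀ g, g ∈ F₁ ↔ g ∈ K₁) (hF₂ : ∀ g, g ∈ F₂ ↔ g ∈ K₂) (hS : S ⊆ F₁) (hT : T ⊆ F₂) :
    S.card * T.card ≤ (F₁ ∩ F₂).card * (S + T).card := by
  rw [← Finset.card_product]
  refine Finset.card_le_mul_card_image_of_maps_to (f := fun p : G × G => p.1 + p.2)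
    (fun p hp => ?_) _ fun b _ => ?_
  · rw [Finset.mem_product] at hp
    exact Finset.add_mem_add hp.1 hp.2
  · rcases Finset.eq_empty_or_nonempty ((S ×ˢ T).filter fun p : G × G => p.1 + p.2 = b)
      with h | ⟨⟨s₀, t₀⟩, h₀⟩
    · simp [h]
    · simp only [Finset.mem_filter, Finset.mem_product] at h₀
      refine Finset.card_le_card_of_injOn (fun p => p.1 - s₀) ?_ ?_
      · rintro ⟨s, t⟩ h
        simp only [Finset.coe_filter, Finset.mem_product, Set.mem_ofPred_eq] at h
        have e : s - s₀ = t₀ - t := by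
          rw [sub_eq_sub_iff_add_eq_add, h.2, add_comm, h₀.2]
        simp only [Finset.coe_inter, Set.mem_inter_iff, Finset.mem_coe, hF₁, hF₂]
        refine ⟨K₁.sub_mem ((hF₁ _).1 (hS h.1.1)) ((hF₁ _).1 (hS h₀.1.1)), ?_⟩
        rw [e]
        exact K₂.sub_mem ((hF₂ _).1 (hT h₀.1.2)) ((hF₂ _).1 (hT h.1.2))
      · rintro ⟨s, t⟩ h ⟨s', t'⟩ h' e
        simp only [Finset.coe_filter, Finset.mem_product, Set.mem_ofPred_eq] at h h'
        have e' : s = s' := sub_left_injective e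
        subst e'
        rw [add_left_cancel (h.2.trans h'.2.symm)]

theorem card_sdiff_bounds_of_periodic {K₁ K₂ : AddSubgroup G} {F₁ F₂ C₁ C₂ : Finset G}
    (hF₁ : ∀ g, g ∈ F₁ ↔ g ∈ K₁) (hF₂ : ∀ g, g ∈ F₂ ↔ g ∈ K₂)
    (hC₁ : ∀ k ∈ K₁, ∀ c ∈ C₁, k + c ∈ C₁) (hC₂ : ∀ k ∈ K₂, ∀ c ∈ C₂, k + c ∈ C₂)
    {x : G} (hx₁ : x ∉ C₁) (hx₂ : x ∈ C₂) :
    F₁.card ≤ (C₂ \ C₁).card + (F₁ ∩ F₂).card ∨ F₂.card ≤ (C₁ \ C₂).card + (F₁ ∩ F₂).card ∨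
      F₂.card ≤ (C₂ \ C₁).card := by
  have hC₁' : ∀ k ∈ K₁, ∀ c, k + c ∈ C₁ ↔ c ∈ C₁ := fun k hk c =>
    ⟨fun h => by simpa using hC₁ _ (K₁.neg_mem hk) _ h, hC₁ k hk c⟩
  have hC₂' : ∀ k ∈ K₂, ∀ c, k + c ∈ C₂ ↔ c ∈ C₂ := fun k hk c =>
    ⟨fun h => by simpa using hC₂ _ (K₂.neg_mem hk) _ h, hC₂ k hk c⟩
  set S := F₁.filter fun s => x + s ∈ C₂ with hS
  set S' := F₁.filter fun s => ¬ x + s ∈ C₂ with hS'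
  set T := F₂.filter fun t => ¬ x + t ∈ C₁ with hT
  set T' := F₂.filter fun t => x + t ∈ C₁ with hT'
  have hSS : S.card + S'.card = F₁.card := Finset.card_filter_add_card_filter_not _
  have hTT : T'.card + T.card = F₂.card := Finset.card_filter_add_card_filter_not _
  have hST : (S + T).card ≤ (C₂ \ C₁).card := by
    rw [← Finset.card_vadd_finset x]
    refine Finset.card_le_card fun y hy => ?_
    obtain ⟨z, hz, rfl⟩ := Finset.mem_vadd_finset.1 hy
    obtain ⟨s, hs, t, ht, rfl⟩ := Finset.mem_add.1 hz
    simp only [hS, hT, Finset.mem_filter, hF₁, hF₂] at hs ht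
    rw [vadd_eq_add, Finset.mem_sdiff]
    refine ⟨?_, ?_⟩
    · rw [show x + (s + t) = t + (x + s) by abel, hC₂' t ht.1]
      exact hs.2
    · rw [show x + (s + t) = s + (x + t) by abel, hC₁' s hs.1]
      exact ht.2
  have hST' : (S' + T').card ≤ (C₁ \ C₂).card := by
    rw [← Finset.card_vadd_finset x]
    refine Finset.card_le_card fun y hy => ?_
    obtain ⟨z, hz, rfl⟩ := Finset.mem_vadd_finset.1 hy
    obtain ⟨s, hs, t, ht, rfl⟩ := Finset.mem_add.1 hz
    simp only [hS', hT', Finset.mem_filter, hF₁, hF₂] at hs ht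
    rw [vadd_eq_add, Finset.mem_sdiff]
    refine ⟨?_, ?_⟩
    · rw [show x + (s + t) = s + (x + t) by abel, hC₁' s hs.1]
      exact ht.2
    · rw [show x + (s + t) = t + (x + s) by abel, hC₂' t ht.1]
      exact hs.2
  have hm : S.card * T.card ≤ (F₁ ∩ F₂).card * (S + T).card := card_mul_card_le_card_add_mul_card_inter hF₁ hF₂
    (Finset.filter_subset _ _ : S ⊆ F₁) (Finset.filter_subset _ _ : T ⊆ F₂)
  have hm' : S'.card * T'.card ≤ (F₁ ∩ F₂).card * (S' + T').card := card_mul_card_le_card_add_mul_card_inter hF₁ hF₂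
    (Finset.filter_subset _ _ : S' ⊆ F₁) (Finset.filter_subset _ _ : T' ⊆ F₂)
  have hpos : 0 < (F₁ ∩ F₂).card :=
    Finset.card_pos.2 ⟨0, by simp [hF₁, hF₂]⟩
  have hSc : (F₁ ∩ F₂).card ≤ S.card := by
    refine Finset.card_le_card fun g hg => ?_
    simp only [Finset.mem_inter, hF₁, hF₂] at hg
    simp only [hS, Finset.mem_filter, hF₁]
    exact ⟨hg.1, by rwa [add_comm, hC₂' g hg.2]⟩
  have hTc : (F₁ ∩ F₂).card ≤ T.card := by
    refine Finset.card_le_card fun g hg => ?_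
    simp only [Finset.mem_inter, hF₁, hF₂] at hg
    simp only [hT, Finset.mem_filter, hF₂]
    exact ⟨hg.2, by rwa [add_comm, hC₁' g hg.1]⟩
  have hSc' : S'.Nonempty → (F₁ ∩ F₂).card ≤ S'.card := by
    rintro ⟨s, hs⟩
    rw [← Finset.card_vadd_finset s]
    refine Finset.card_le_card fun y hy => ?_
    obtain ⟨g, hg, rfl⟩ := Finset.mem_vadd_finset.1 hy
    simp only [Finset.mem_inter, hF₁, hF₂] at hg
    simp only [hS', Finset.mem_filter, hF₁, vadd_eq_add] at hs ⊢
    refine ⟨K₁.add_mem hs.1 hg.1, ?_⟩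
    rw [show x + (s + g) = g + (x + s) by abel, hC₂' g hg.2]
    exact hs.2
  have hTc' : T'.Nonempty → (F₁ ∩ F₂).card ≤ T'.card := by
    rintro ⟨t, ht⟩
    rw [← Finset.card_vadd_finset t]
    refine Finset.card_le_card fun y hy => ?_
    obtain ⟨g, hg, rfl⟩ := Finset.mem_vadd_finset.1 hy
    simp only [Finset.mem_inter, hF₁, hF₂] at hg
    simp only [hT', Finset.mem_filter, hF₂, vadd_eq_add] at ht ⊢
    refine ⟨K₂.add_mem ht.1 hg.2, ?_⟩
    rw [show x + (t + g) = g + (x + t) by abel, hC₁' g hg.1]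
    exact ht.2
  have key : ∀ {h a b c : ℕ}, 0 < h → h ≤ a → h ≤ b → a * b ≤ h * c → a + b ≤ c + h := by
    intro h a b c h0 ha hb hab
    obtain ⟨a, rfl⟩ := Nat.exists_eq_add_of_le ha
    obtain ⟨b, rfl⟩ := Nat.exists_eq_add_of_le hb
    have : h * (h + a + b) ≤ h * c := by nlinarith
    have := Nat.le_of_mul_le_mul_left this h0
    omega
  have k₁ := key hpos hSc hTc hm
  rcases S'.eq_empty_or_nonempty with h | hs
  · rw [h, Finset.card_empty] at hSS
    omega
  rcases T'.eq_empty_or_nonempty with h | ht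
  · rw [h, Finset.card_empty] at hTT
    omega
  have k₂ := key hpos (hSc' hs) (hTc' ht) hm'
  omega

theorem HasPeriodBound.union {C₁ C₂ : Finset G} {m : ℕ} (h₁ : HasPeriodBound C₁ m)
    (h₂ : HasPeriodBound C₂ m) : HasPeriodBound (C₁ ∪ C₂) m := by
  by_cases h₂₁ : C₂ ⊆ C₁
  · rwa [Finset.union_eq_left.2 h₂₁]
  by_cases h₁₂ : C₁ ⊆ C₂
  · rwa [Finset.union_eq_right.2 h₁₂]
  obtain ⟨x, hx₂, hx₁⟩ := Finset.not_subset.1 h₂₁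
  obtain ⟨y, hy₁, hy₂⟩ := Finset.not_subset.1 h₁₂
  obtain ⟨K₁, F₁, hF₁, hC₁, hm₁⟩ := h₁
  obtain ⟨K₂, F₂, hF₂, hC₂, hm₂⟩ := h₂
  refine ⟨K₁ ⊓ K₂, F₁ ∩ F₂, fun g => by simp [hF₁, hF₂], ?_, ?_⟩
  · intro k hk c hc
    rw [Finset.mem_union] at hc ⊢
    exact hc.imp (hC₁ k hk.1 c) (hC₂ k hk.2 c)
  · have b₁ := card_sdiff_bounds_of_periodic hF₁ hF₂ hC₁ hC₂ hx₁ hx₂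
    have b₂ := card_sdiff_bounds_of_periodic hF₂ hF₁ hC₂ hC₁ hy₂ hy₁
    rw [Finset.inter_comm F₂ F₁] at b₂
    have e₁ : (C₁ ∪ C₂).card = (C₂ \ C₁).card + C₁.card := by
      rw [Finset.union_comm, Finset.card_sdiff_add_card]
    have e₂ : (C₁ ∪ C₂).card = (C₁ \ C₂).card + C₂.card := by
      rw [Finset.card_sdiff_add_card]
    omega

theorem exists_finset_mem_iff_mem_stabilizer {A : Finset G} (hA : A.Nonempty) :
    ∃ F : Finset G, ∀ g, g ∈ F ↔ g ∈ AddAction.stabilizer G (A : Set G) := by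
  classical
  obtain ⟨a, ha⟩ := hA
  refine ⟨(A.image (· - a)).filter (· ∈ AddAction.stabilizer G (A : Set G)), fun g => ?_⟩
  rw [Finset.mem_filter, and_iff_right_iff_imp]
  intro hg
  have : g +ᵥ a ∈ (A : Set G) := by
    rw [← AddAction.mem_stabilizer_iff.1 hg]
    exact Set.vadd_mem_vadd_set ha
  exact Finset.mem_image.2 ⟨g + a, this, by simp⟩

theorem exists_hasPeriodBound_of_mem (N : ℕ) : ∀ (A B : Finset G), B.card ≤ N →
    ∀ a ∈ A, ∀ b ∈ B, ∃ C ⊆ A + B, a + b ∈ C ∧ HasPeriodBound C (A.card + B.card) := by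
  induction N with
  | zero =>
    intro A B hB a _ b hb
    have := Finset.card_pos.2 ⟨b, hb⟩
    omega
  | succ N ih =>
    intro A B hB a ha b hb
    by_cases h : ∀ a₁ ∈ A, ∀ b₁ ∈ B, a₁ + b₁ - b ∈ A
    · have hst : ∀ b₁ ∈ B, b₁ - b ∈ AddAction.stabilizer G (A : Set G) := by
        intro b₁ hb₁
        rw [AddAction.mem_stabilizer_iff, ← Finset.coe_vadd_finset, Finset.coe_inj]
        refine Finset.eq_of_subset_of_card_le ?_ (Finset.card_vadd_finset _ _).ge
        intro y hy
        obtain ⟨z, hz, rfl⟩ := Finset.mem_vadd_finset.1 hy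
        rw [vadd_eq_add, show b₁ - b + z = z + b₁ - b by abel]
        exact h z hz b₁ hb₁
      obtain ⟨F, hF⟩ := exists_finset_mem_iff_mem_stabilizer ⟨a, ha⟩
      refine ⟨b +ᵥ A, ?_, ?_, AddAction.stabilizer G (A : Set G), F, hF, ?_, ?_⟩
      · intro y hy
        obtain ⟨z, hz, rfl⟩ := Finset.mem_vadd_finset.1 hy
        rw [vadd_eq_add, add_comm b z]
        exact Finset.add_mem_add hz hb
      · rw [add_comm]
        exact Finset.vadd_mem_vadd_finset ha
      · intro k hk y hy
        obtain ⟨z, hz, rfl⟩ := Finset.mem_vadd_finset.1 hy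
        have hkz : k +ᵥ z ∈ (A : Set G) := by
          rw [← AddAction.mem_stabilizer_iff.1 hk]
          exact Set.vadd_mem_vadd_set hz
        rw [vadd_eq_add, show k + (b + z) = b + (k + z) by abel]
        exact Finset.vadd_mem_vadd_finset (Finset.mem_coe.1 hkz)
      · rw [Finset.card_vadd_finset]
        refine Nat.add_le_add_left ?_ _
        exact Finset.card_le_card_of_injOn (· - b) (fun b₁ hb₁ => (hF _).2 (hst b₁ hb₁))
          sub_left_injective.injOn
    · push Not at h
      obtain ⟨a₁, ha₁, b₁, hb₁, hab⟩ := h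
      set e := a₁ - b with he
      have hlt : (B ∩ (-e +ᵥ A)).card < B.card := by
        refine Finset.card_lt_card ⟨Finset.inter_subset_left, fun hsub => hab ?_⟩
        obtain ⟨z, hz, hzb⟩ := Finset.mem_vadd_finset.1 (Finset.mem_inter.1 (hsub hb₁)).2
        rw [vadd_eq_add] at hzb
        rw [← hzb, show a₁ + (-e + z) - b = z by rw [he]; abel]
        exact hz
      have hb' : b ∈ B ∩ (-e +ᵥ A) := by
        refine Finset.mem_inter.2 ⟨hb, Finset.mem_vadd_finset.2 ⟨a₁, ha₁, ?_⟩⟩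
        rw [vadd_eq_add, he]
        abel
      obtain ⟨C, hC, habC, hCm⟩ := ih (A ∪ (e +ᵥ B)) (B ∩ (-e +ᵥ A)) (by omega) a
        (Finset.mem_union_left _ ha) b hb'
      refine ⟨C, hC.trans ?_, habC, ?_⟩
      · intro y hy
        obtain ⟨u, hu, v, hv, rfl⟩ := Finset.mem_add.1 hy
        obtain ⟨hvB, hvA⟩ := Finset.mem_inter.1 hv
        rcases Finset.mem_union.1 hu with hu | hu
        · exact Finset.add_mem_add hu hvB
        · obtain ⟨z, hz, rfl⟩ := Finset.mem_vadd_finset.1 hu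
          obtain ⟨w, hw, rfl⟩ := Finset.mem_vadd_finset.1 hvA
          rw [vadd_eq_add, vadd_eq_add, show e + z + (-e + w) = w + z by abel]
          exact Finset.add_mem_add hw hz
      · have e₁ : (B ∩ (-e +ᵥ A)).card = (A ∩ (e +ᵥ B)).card := by
          rw [← Finset.card_vadd_finset e, Finset.vadd_finset_inter, vadd_neg_vadd,
            Finset.inter_comm]
        rwa [e₁, Finset.card_union_add_card_inter, Finset.card_vadd_finset] at hCm

theorem hasPeriodBound_add {A B : Finset G} (hA : A.Nonempty) (hB : B.Nonempty) :
    HasPeriodBound (A + B) (A.card + B.card) := by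
  suffices h : ∀ S : Finset G, S.Nonempty → S ⊆ A + B →
      ∃ C ⊆ A + B, S ⊆ C ∧ HasPeriodBound C (A.card + B.card) by
    obtain ⟨C, hC, hC', hb⟩ := h _ (hA.add hB) subset_rfl
    rwa [hC'.antisymm hC]
  have hmem : ∀ x ∈ A + B, ∃ C ⊆ A + B, x ∈ C ∧ HasPeriodBound C (A.card + B.card) := by
    intro x hx
    obtain ⟨a, ha, b, hb, rfl⟩ := Finset.mem_add.1 hx
    exact exists_hasPeriodBound_of_mem _ A B le_rfl a ha b hb
  intro S hS
  induction hS using Finset.Nonempty.cons_induction with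
  | singleton x =>
    intro h
    simpa using hmem x (by simpa using h)
  | cons x S hx _ ih =>
    intro h
    rw [Finset.cons_eq_insert, Finset.insert_subset_iff] at h
    obtain ⟨C, hC, hSC, hb⟩ := ih h.2
    obtain ⟨C', hC', hxC', hb'⟩ := hmem x h.1
    refine ⟨C' ∪ C, Finset.union_subset hC' hC, ?_, hb'.union hb⟩
    rw [Finset.cons_eq_insert, Finset.insert_subset_iff]
    exact ⟨Finset.mem_union_left _ hxC', hSC.trans Finset.subset_union_right⟩

/-- **Kneser's theorem** for two summands, in terms of a finite overgroup of the stabilizer. -/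
theorem card_add_card_le_of_stabilizer_le {A B F : Finset G} (hA : A.Nonempty) (hB : B.Nonempty)
    (hF : ∀ g ∈ AddAction.stabilizer G ((A + B : Finset G) : Set G), g ∈ F) :
    A.card + B.card ≤ (A + B).card + F.card := by
  obtain ⟨K, F', hF', hK, hm⟩ := hasPeriodBound_add hA hB
  have : F'.card ≤ F.card := by
    refine Finset.card_le_card fun k hk => hF k ?_
    rw [AddAction.mem_stabilizer_iff, ← Finset.coe_vadd_finset, Finset.coe_inj]
    refine Finset.eq_of_subset_of_card_le ?_ (Finset.card_vadd_finset _ _).ge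
    intro y hy
    obtain ⟨z, hz, rfl⟩ := Finset.mem_vadd_finset.1 hy
    exact hK k ((hF' k).1 hk) z hz
  omega

theorem sum_card_le_of_stabilizer_le {ι : Type*} {s : Finset ι} (hs : s.Nonempty)
    {A : ι → Finset G} (hA : ∀ i, (A i).Nonempty) {F : Finset G}
    (hF : ∀ g ∈ AddAction.stabilizer G ((∑ i ∈ s, A i : Finset G) : Set G), g ∈ F) :
    ∑ i ∈ s, (A i).card + F.card ≤ (∑ i ∈ s, A i).card + s.card * F.card := by
  induction hs using Finset.Nonempty.cons_induction with
  | singleton i => simp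
  | cons i s hi hs ih =>
    rw [Finset.sum_cons, Finset.sum_cons, Finset.card_cons]
    rw [Finset.sum_cons] at hF
    have hne : (∑ j ∈ s, A j).Nonempty :=
      Finset.sum_induction _ Finset.Nonempty (fun _ _ h h' => h.add h') Finset.zero_nonempty
        fun j _ => hA j
    have h₁ := card_add_card_le_of_stabilizer_le (hA i) hne hF
    have h₂ := ih fun g hg => hF g <| by
      rw [AddAction.mem_stabilizer_iff, ← Finset.coe_vadd_finset, Finset.coe_inj] at hg ⊢
      rw [← add_vadd_comm, hg]
    linarith

theorem sum_add_of_add_self {ι : Type*} {s : Finset ι} (hs : s.Nonempty) (A : ι → Finset G)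
    {F : Finset G} (hF : F + F = F) : ∑ i ∈ s, (A i + F) = ∑ i ∈ s, A i + F := by
  induction hs using Finset.Nonempty.cons_induction with
  | singleton i => simp
  | cons i s hi hs ih =>
    rw [Finset.sum_cons, Finset.sum_cons, ih, add_add_add_comm, hF]

end

theorem stmt12 {G : Type*} [AddCommGroup G] [DecidableEq G] (n : ℕ) (hn : 1 ≤ n)
    (A : Fin n → Finset G) (hA : ∀ i, (A i).Nonempty)
    (H : AddSubgroup G) (hH : H = AddAction.stabilizer G ((↑(∑ i, A i) : Set G))) :
    (∑ i, (((A i : Set G) + (H : Set G)).ncard : ℤ)) - (n - 1) * Nat.card H ≤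
      ((∑ i, A i).card : ℤ) := by
  have hne : (∑ i, A i).Nonempty :=
    Finset.sum_induction _ Finset.Nonempty (fun _ _ h h' => h.add h') Finset.zero_nonempty
      fun j _ => hA j
  obtain ⟨F, hF⟩ := exists_finset_mem_iff_mem_stabilizer hne
  rw [← hH] at hF
  have hFH : (H : Set G) = F := Set.ext fun g => (hF g).symm
  have h0 : (0 : G) ∈ F := (hF 0).2 H.zero_mem
  have hFF : F + F = F := by
    refine Finset.Subset.antisymm (Finset.add_subset_iff.2 fun x hx y hy => ?_)
      (Finset.subset_add_left _ h0)
    exact (hF _).2 (H.add_mem ((hF x).1 hx) ((hF y).1 hy))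
  have hSF : ∑ i, A i + F = ∑ i, A i := by
    refine Finset.Subset.antisymm (Finset.add_subset_iff.2 fun x hx g hg => ?_)
      (Finset.subset_add_left _ h0)
    have hg' := (hF g).1 hg
    rw [hH, AddAction.mem_stabilizer_iff, ← Finset.coe_vadd_finset, Finset.coe_inj] at hg'
    rw [← hg', add_comm]
    exact Finset.vadd_mem_vadd_finset hx
  have huniv : (Finset.univ : Finset (Fin n)).Nonempty := ⟨⟨0, hn⟩, Finset.mem_univ _⟩
  have hsum : ∑ i, (A i + F) = ∑ i, A i := (sum_add_of_add_self huniv A hFF).trans hSF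
  have key := sum_card_le_of_stabilizer_le huniv (A := fun i => A i + F)
    (fun i => (hA i).add ⟨0, h0⟩) (F := F) (fun g hg => by
      rw [hsum, ← hH] at hg
      exact (hF g).2 hg)
  rw [hsum, Finset.card_univ, Fintype.card_fin] at key
  have hcard : Nat.card H = F.card := by
    rw [← Set.ncard_coe_finset F, ← hFH]
    rfl
  have hAi : ∀ i, ((A i : Set G) + (H : Set G)).ncard = (A i + F).card := fun i => by
    rw [hFH, ← Finset.coe_add, Set.ncard_coe_finset]
  simp only [hAi, hcard]
  zify at key
  linarith
end
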